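/- The only pair of natural numbers (n, m) with n ≥ 6 and m ≥ 8 satisfying C(m, 4) = C(n, 3) + 1 is (n, m) = (34, 21), with C(21, 4) = 5985 = C(34, 3) + 1; and there are no natural numbers n ≥ 8, m ≥ 6 satisfying C(m, 3) = C(n, 4) + 1, where C denotes the binomial coefficient. -/

import Mathlib

/-- The free module of rank four with basis `1, ω, τ, ωτ`, where
`ω ^ 2 = 2 * τ + 3 * x` and `τ ^ 2 = 3 * x ^ 2 - 1 - y * ω`. -/
@[ext] structure Quart (S : Type*) (x y : ℤ) where
  (r0 r1 r2 r3 : S)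

namespace Quart

variable {S : Type*} [CommRing S] {x y : ℤ}

instance : Zero (Quart S x y) := ⟨⟨0, 0, 0, 0⟩⟩
instance : One (Quart S x y) := ⟨⟨1, 0, 0, 0⟩⟩
instance : Add (Quart S x y) :=
  ⟨fun a b => ⟨a.r0 + b.r0, a.r1 + b.r1, a.r2 + b.r2, a.r3 + b.r3⟩⟩
instance : Neg (Quart S x y) := ⟨fun a => ⟨-a.r0, -a.r1, -a.r2, -a.r3⟩⟩
instance : Sub (Quart S x y) :=
  ⟨fun a b => ⟨a.r0 - b.r0, a.r1 - b.r1, a.r2 - b.r2, a.r3 - b.r3⟩⟩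
instance : NatCast (Quart S x y) := ⟨fun n => ⟨n, 0, 0, 0⟩⟩
instance : IntCast (Quart S x y) := ⟨fun n => ⟨n, 0, 0, 0⟩⟩
instance : Mul (Quart S x y) :=
  ⟨fun a b =>
    ⟨a.r0 * b.r0 + 3 * x * (a.r1 * b.r1) + (3 * x ^ 2 - 1) * (a.r2 * b.r2)
        + 2 * (3 * x ^ 2 - 1) * (a.r1 * b.r3 + a.r3 * b.r1)
        - 3 * x * y * (a.r2 * b.r3 + a.r3 * b.r2) + 3 * x * (3 * x ^ 2 - 1) * (a.r3 * b.r3),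
      a.r0 * b.r1 + a.r1 * b.r0 - y * (a.r2 * b.r2) - 2 * y * (a.r1 * b.r3 + a.r3 * b.r1)
        + (3 * x ^ 2 - 1) * (a.r2 * b.r3 + a.r3 * b.r2) - 3 * x * y * (a.r3 * b.r3),
      a.r0 * b.r2 + a.r2 * b.r0 + 2 * (a.r1 * b.r1) + 3 * x * (a.r1 * b.r3 + a.r3 * b.r1)
        - 2 * y * (a.r2 * b.r3 + a.r3 * b.r2) + 2 * (3 * x ^ 2 - 1) * (a.r3 * b.r3),
      a.r0 * b.r3 + a.r3 * b.r0 + a.r1 * b.r2 + a.r2 * b.r1 - 2 * y * (a.r3 * b.r3)⟩⟩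

section
variable (a b : Quart S x y) (n : ℕ) (z : ℤ)
@[simp] lemma zero_r0 : (0 : Quart S x y).r0 = 0 := rfl
@[simp] lemma zero_r1 : (0 : Quart S x y).r1 = 0 := rfl
@[simp] lemma zero_r2 : (0 : Quart S x y).r2 = 0 := rfl
@[simp] lemma zero_r3 : (0 : Quart S x y).r3 = 0 := rfl
@[simp] lemma one_r0 : (1 : Quart S x y).r0 = 1 := rfl
@[simp] lemma one_r1 : (1 : Quart S x y).r1 = 0 := rfl
@[simp] lemma one_r2 : (1 : Quart S x y).r2 = 0 := rfl
@[simp] lemma one_r3 : (1 : Quart S x y).r3 = 0 := rfl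
@[simp] lemma add_r0 : (a + b).r0 = a.r0 + b.r0 := rfl
@[simp] lemma add_r1 : (a + b).r1 = a.r1 + b.r1 := rfl
@[simp] lemma add_r2 : (a + b).r2 = a.r2 + b.r2 := rfl
@[simp] lemma add_r3 : (a + b).r3 = a.r3 + b.r3 := rfl
@[simp] lemma sub_r0 : (a - b).r0 = a.r0 - b.r0 := rfl
@[simp] lemma sub_r1 : (a - b).r1 = a.r1 - b.r1 := rfl
@[simp] lemma sub_r2 : (a - b).r2 = a.r2 - b.r2 := rfl
@[simp] lemma sub_r3 : (a - b).r3 = a.r3 - b.r3 := rfl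
@[simp] lemma neg_r0 : (-a).r0 = -a.r0 := rfl
@[simp] lemma neg_r1 : (-a).r1 = -a.r1 := rfl
@[simp] lemma neg_r2 : (-a).r2 = -a.r2 := rfl
@[simp] lemma neg_r3 : (-a).r3 = -a.r3 := rfl
@[simp] lemma natCast_r0 : (n : Quart S x y).r0 = n := rfl
@[simp] lemma natCast_r1 : (n : Quart S x y).r1 = 0 := rfl
@[simp] lemma natCast_r2 : (n : Quart S x y).r2 = 0 := rfl
@[simp] lemma natCast_r3 : (n : Quart S x y).r3 = 0 := rfl
@[simp] lemma intCast_r0 : (z : Quart S x y).r0 = z := rfl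
@[simp] lemma intCast_r1 : (z : Quart S x y).r1 = 0 := rfl
@[simp] lemma intCast_r2 : (z : Quart S x y).r2 = 0 := rfl
@[simp] lemma intCast_r3 : (z : Quart S x y).r3 = 0 := rfl
lemma mul_r0 : (a * b).r0 = a.r0 * b.r0 + 3 * x * (a.r1 * b.r1)
    + (3 * x ^ 2 - 1) * (a.r2 * b.r2) + 2 * (3 * x ^ 2 - 1) * (a.r1 * b.r3 + a.r3 * b.r1)
    - 3 * x * y * (a.r2 * b.r3 + a.r3 * b.r2) + 3 * x * (3 * x ^ 2 - 1) * (a.r3 * b.r3) := rfl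
lemma mul_r1 : (a * b).r1 = a.r0 * b.r1 + a.r1 * b.r0 - y * (a.r2 * b.r2)
    - 2 * y * (a.r1 * b.r3 + a.r3 * b.r1)
    + (3 * x ^ 2 - 1) * (a.r2 * b.r3 + a.r3 * b.r2) - 3 * x * y * (a.r3 * b.r3) := rfl
lemma mul_r2 : (a * b).r2 = a.r0 * b.r2 + a.r2 * b.r0 + 2 * (a.r1 * b.r1)
    + 3 * x * (a.r1 * b.r3 + a.r3 * b.r1) - 2 * y * (a.r2 * b.r3 + a.r3 * b.r2)
    + 2 * (3 * x ^ 2 - 1) * (a.r3 * b.r3) := rfl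
lemma mul_r3 : (a * b).r3 = a.r0 * b.r3 + a.r3 * b.r0 + a.r1 * b.r2 + a.r2 * b.r1
    - 2 * y * (a.r3 * b.r3) := rfl
end

instance : CommRing (Quart S x y) where
  add_assoc a b c := by ext <;> simp <;> ring
  zero_add a := by ext <;> simp
  add_zero a := by ext <;> simp
  add_comm a b := by ext <;> simp <;> ring
  nsmul := nsmulRec
  zsmul := zsmulRec
  neg_add_cancel a := by ext <;> simp
  sub_eq_add_neg a b := by ext <;> simp <;> ring
  mul_assoc a b c := by ext <;> simp only [mul_r0, mul_r1, mul_r2, mul_r3] <;> ring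
  mul_comm a b := by ext <;> simp only [mul_r0, mul_r1, mul_r2, mul_r3] <;> ring
  one_mul a := by ext <;> simp [mul_r0, mul_r1, mul_r2, mul_r3]
  mul_one a := by ext <;> simp [mul_r0, mul_r1, mul_r2, mul_r3]
  zero_mul a := by ext <;> simp [mul_r0, mul_r1, mul_r2, mul_r3]
  mul_zero a := by ext <;> simp [mul_r0, mul_r1, mul_r2, mul_r3]
  left_distrib a b c := by
    ext <;> simp only [mul_r0, mul_r1, mul_r2, mul_r3, add_r0, add_r1, add_r2, add_r3] <;> ring
  right_distrib a b c := by
    ext <;> simp only [mul_r0, mul_r1, mul_r2, mul_r3, add_r0, add_r1, add_r2, add_r3] <;> ring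
  natCast_zero := by ext <;> simp
  natCast_succ n := by ext <;> simp
  intCast_ofNat n := by ext <;> simp
  intCast_negSucc n := by ext <;> simp

/-- The ring homomorphism determined by the images of `ω` and `τ`. -/
def lift {T : Type*} [CommRing T] (w t : T) (h₁ : w ^ 2 = 2 * t + 3 * x)
    (h₂ : t ^ 2 = 3 * x ^ 2 - 1 - y * w) : Quart ℤ x y →+* T where
  toFun a := a.r0 + a.r1 * w + a.r2 * t + a.r3 * (w * t)
  map_one' := by simp
  map_zero' := by simp
  map_add' a b := by simp; ring
  map_mul' a b := by
    simp only [mul_r0, mul_r1, mul_r2, mul_r3]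
    push_cast
    linear_combination (-(a.r1 * b.r1 : T) - (a.r1 * b.r3 + a.r3 * b.r1) * t
        - a.r3 * b.r3 * t ^ 2 + (a.r2 * b.r3 + a.r3 * b.r2) * y) * h₁
      + (-(a.r2 * b.r2 : T) - (a.r2 * b.r3 + a.r3 * b.r2) * w - 2 * (a.r1 * b.r3 + a.r3 * b.r1)
        - a.r3 * b.r3 * (2 * t + 3 * x)) * h₂

lemma lift_apply {T : Type*} [CommRing T] (w t : T) (h₁ : w ^ 2 = 2 * t + 3 * x)
    (h₂ : t ^ 2 = 3 * x ^ 2 - 1 - y * w) (a : Quart ℤ x y) :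
    lift w t h₁ h₂ a = a.r0 + a.r1 * w + a.r2 * t + a.r3 * (w * t) := rfl

end Quart

namespace Quart
open Polynomial NumberField

/-- The minimal polynomial of `ω`. -/
noncomputable def poly (x y : ℤ) (S : Type*) [CommRing S] : S[X] :=
  X ^ 4 - C (6 * x : S) * X ^ 2 + C (4 * y : S) * X + C (4 - 3 * x ^ 2 : S)

lemma poly_natDegree {S : Type*} [CommRing S] [Nontrivial S] (x y : ℤ) :
    (poly x y S).natDegree = 4 := by
  unfold poly; compute_degree!

lemma poly_monic {S : Type*} [CommRing S] [Nontrivial S] (x y : ℤ) :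
    (poly x y S).Monic := by
  unfold poly; monicity!

lemma poly_map {S T : Type*} [CommRing S] [CommRing T] (f : S →+* T) (x y : ℤ) :
    (poly x y S).map f = poly x y T := by
  simp only [poly, Polynomial.map_add, Polynomial.map_sub, Polynomial.map_mul, Polynomial.map_pow,
    map_X, Polynomial.map_C]
  simp only [map_sub, map_mul, map_pow, map_ofNat, map_intCast]

lemma poly_eval₂ {S T : Type*} [CommRing S] [CommRing T] (f : S →+* T) (x y : ℤ) (a : T) :
    (poly x y S).eval₂ f a = a ^ 4 - 6 * x * a ^ 2 + 4 * y * a + (4 - 3 * x ^ 2) := by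
  simp only [poly, eval₂_add, eval₂_sub, eval₂_mul, eval₂_pow, eval₂_X, eval₂_C]
  simp only [map_sub, map_mul, map_pow, map_ofNat, map_intCast]

/-- The quartic is irreducible as soon as it is so modulo a prime. -/
lemma poly_irreducible (x y : ℤ) (q : ℕ) [Fact q.Prime]
    (h1 : ∀ a : ZMod q, a ^ 4 - 6 * x * a ^ 2 + 4 * y * a + (4 - 3 * x ^ 2) ≠ 0)
    (h2 : ∀ s z : ZMod q, s * (s ^ 2 - 6 * x - 2 * z) ≠ 4 * y ∨
      z * (s ^ 2 - 6 * x - z) ≠ 4 - 3 * x ^ 2) : Irreducible (poly x y ℚ) := by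
  have hm := poly_monic (S := ℤ) x y
  have hq : Irreducible (poly x y (ZMod q)) := by
    have hmq := poly_monic (S := ZMod q) x y
    rw [hmq.irreducible_iff_lt_natDegree_lt (by
      intro h; have := poly_natDegree (S := ZMod q) x y; rw [h] at this; simp at this)]
    rintro g hg hd ⟨f, hf⟩
    rw [poly_natDegree] at hd
    simp only [Nat.reduceDiv, Finset.mem_Ioc] at hd
    have hfm : f.Monic := by
      rw [hf] at hmq; exact hg.of_mul_monic_left hmq
    have hdeg : g.natDegree + f.natDegree = 4 := by
      rw [← hg.natDegree_mul hfm, ← hf, poly_natDegree]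
    obtain h | h : g.natDegree = 1 ∨ g.natDegree = 2 := by omega
    · have e := hg.as_sum
      rw [h] at e
      simp at e
      have := congrArg (eval₂ (RingHom.id _) (-(g.coeff 0))) hf
      rw [poly_eval₂, eval₂_mul] at this
      refine h1 (-(g.coeff 0)) (this.trans ?_)
      rw [e]
      simp
    · have e := hg.as_sum
      have e' := hfm.as_sum
      rw [h] at e
      rw [show f.natDegree = 2 by omega] at e'
      simp [Finset.sum_range_succ] at e e'
      generalize g.coeff 0 = a at e
      generalize g.coeff 1 = b at e
      generalize f.coeff 0 = a' at e'
      generalize f.coeff 1 = b' at e'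
      subst e e'
      have hexp : (X ^ 2 + (C a + C b * X)) * (X ^ 2 + (C a' + C b' * X)) =
          X ^ 4 + C (b + b') * X ^ 3 + C (a + a' + b * b') * X ^ 2 + C (a * b' + a' * b) * X
            + C (a * a') := by
        simp only [C_add, C_mul]; ring
      rw [hexp] at hf
      have c0 := congrArg (coeff · 0) hf
      have c1 := congrArg (coeff · 1) hf
      have c2 := congrArg (coeff · 2) hf
      have c3 := congrArg (coeff · 3) hf
      simp [poly, coeff_X, coeff_C, coeff_X_pow, -map_add, -map_mul, -map_sub, -map_pow]
        at c0 c1 c2 c3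
      have hb : b' = -b := by linear_combination -c3
      subst hb
      have ha : a' = b ^ 2 - 6 * x - a := by linear_combination -c2
      subst ha
      rcases h2 b a with h | h
      · exact h (by linear_combination -c1)
      · exact h (by linear_combination -c0)
  have hZ : Irreducible (poly x y ℤ) := by
    refine hm.irreducible_of_irreducible_map (Int.castRingHom (ZMod q)) _ ?_
    rwa [poly_map]
  have := (hm.irreducible_iff_irreducible_map_fraction_map (K := ℚ)).1 hZ
  rwa [poly_map] at this

lemma exists_coord_aux (x y : ℤ) (K : Type*) [Field K] [NumberField K] (φ : Quart ℤ x y →+* 𝓞 K)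
    (hinj : Function.Injective φ) (hrank : Units.rank K ≤ 2) (ψ : K →+* ℝ) :
    ∃ r ≤ 2, ∃ g : Additive (Quart ℤ x y)ˣ →+ (Fin r → ℤ), Function.Surjective g ∧
      ∀ u : (Quart ℤ x y)ˣ, g (.ofMul u) = 0 → u = 1 ∨ u = -1 := by
  have htors : ∀ u : (𝓞 K)ˣ, u ∈ Units.torsion K → u = 1 ∨ u = -1 := by
    intro u hu
    let ψ' : 𝓞 K →+* ℝ := ψ.comp (algebraMap (𝓞 K) K)
    have hψ : Function.Injective ψ' := ψ.injective.comp RingOfIntegers.coe_injective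
    obtain ⟨n, hn, hun⟩ := isOfFinOrder_iff_pow_eq_one.1 ((CommGroup.mem_torsion _).1 hu)
    have h1 : (ψ' u) ^ n = 1 := by
      rw [← map_pow, ← Units.val_pow_eq_pow_val, hun]; simp
    have h2 : |ψ' u| = 1 := by
      rw [← pow_eq_one_iff_of_nonneg (abs_nonneg _) hn.ne', ← abs_pow, h1, abs_one]
    rcases abs_eq_abs.1 (h2.trans abs_one.symm) with h | h
    · left; ext1; apply hψ; simp [h]
    · right; ext1; apply hψ; simp [h]
  let f : Additive (Quart ℤ x y)ˣ →+ Units.dirichletUnitTheorem.logSpace K :=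
    (Units.logEmbedding K).comp (MonoidHom.toAdditive (Units.map (φ : Quart ℤ x y →* 𝓞 K)))
  let L : Submodule ℤ (Units.dirichletUnitTheorem.logSpace K) := LinearMap.range f.toIntLinearMap
  have hLe : L ≤ Units.unitLattice K := by
    rintro _ ⟨u, rfl⟩
    exact ⟨MonoidHom.toAdditive (Units.map (φ : Quart ℤ x y →* 𝓞 K)) u, trivial, rfl⟩
  have hinc := Submodule.inclusion_injective hLe
  classical
  have : Module.Finite ℤ (Units.unitLattice K) := ZLattice.module_finite ℝ _
  have : Module.Finite ℤ L := Module.Finite.of_injective _ hinc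
  have hL : Module.finrank ℤ L ≤ 2 :=
    (LinearMap.finrank_le_finrank_of_injective hinc).trans (by rwa [Units.unitLattice_rank])
  let b := Module.finBasis ℤ L
  refine ⟨Module.finrank ℤ L, hL,
    (b.equivFun.toLinearMap.toAddMonoidHom.comp f.toIntLinearMap.rangeRestrict.toAddMonoidHom),
    ?_, ?_⟩
  · intro v
    obtain ⟨u, hu⟩ := f.toIntLinearMap.surjective_rangeRestrict (b.equivFun.symm v)
    refine ⟨u, ?_⟩
    change b.equivFun (f.toIntLinearMap.rangeRestrict u) = v
    rw [hu, LinearEquiv.apply_symm_apply]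
  · intro u hu
    have h1 : f (.ofMul u) = 0 := by
      have : f.toIntLinearMap.rangeRestrict (.ofMul u) = 0 := by
        exact b.equivFun.injective (Eq.trans hu (map_zero _).symm)
      exact congrArg Subtype.val this
    have h2 : Units.map (φ : Quart ℤ x y →* 𝓞 K) u ∈ Units.torsion K :=
      Units.dirichletUnitTheorem.logEmbedding_eq_zero_iff.1 h1
    rcases htors _ h2 with h | h
    · left; ext1; apply hinj; simpa using congrArg Units.val h
    · right; ext1; apply hinj; simpa using congrArg Units.val h

theorem exists_coord (x y : ℤ) (hirr : Irreducible (poly x y ℚ))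
    (hr : ∃ r : ℝ, r ^ 4 - 6 * x * r ^ 2 + 4 * y * r + (4 - 3 * x ^ 2) = 0)
    (hc : ∃ z : ℂ, z ^ 4 - 6 * x * z ^ 2 + 4 * y * z + (4 - 3 * x ^ 2) = 0 ∧ z.im ≠ 0) :
    ∃ r ≤ 2, ∃ g : Additive (Quart ℤ x y)ˣ →+ (Fin r → ℤ), Function.Surjective g ∧
      ∀ u : (Quart ℤ x y)ˣ, g (.ofMul u) = 0 → u = 1 ∨ u = -1 := by
  have : Fact (Irreducible (poly x y ℚ)) := ⟨hirr⟩
  let K := AdjoinRoot (poly x y ℚ)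
  have hm := poly_monic (S := ℚ) x y
  have : CharZero K := charZero_of_injective_algebraMap (algebraMap ℚ K).injective
  let B := AdjoinRoot.powerBasis hirr.ne_zero
  have hfin : Module.finrank ℚ K = 4 := by
    rw [B.finrank, AdjoinRoot.powerBasis_dim, poly_natDegree]
  have : FiniteDimensional ℚ K := Module.finite_of_finrank_pos (by omega)
  have : NumberField K := {}
  let w : K := AdjoinRoot.root (poly x y ℚ)
  have hw : w ^ 4 - 6 * x * w ^ 2 + 4 * y * w + (4 - 3 * x ^ 2) = 0 := by
    have := AdjoinRoot.eval₂_root (poly x y ℚ)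
    rwa [poly_eval₂] at this
  let t : K := (w ^ 2 - 3 * x) / 2
  have ht1 : w ^ 2 = 2 * t + 3 * x := by simp only [t]; ring
  have ht2 : t ^ 2 = 3 * x ^ 2 - 1 - y * w := by
    simp only [t]; linear_combination hw / 4
  have hwi : IsIntegral ℤ w := by
    refine ⟨poly x y ℤ, poly_monic x y, ?_⟩
    rw [poly_eval₂, hw]
  have hti : IsIntegral ℤ t := by
    refine IsIntegral.of_pow (n := 2) (by norm_num) ?_
    rw [ht2]
    have := ((isIntegral_algebraMap (R := ℤ) (A := K) (x := 3 * x ^ 2 - 1))).sub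
      ((isIntegral_algebraMap (R := ℤ) (A := K) (x := y)).mul hwi)
    simpa using this
  obtain ⟨w', hw'⟩ : ∃ w' : 𝓞 K, algebraMap (𝓞 K) K w' = w := ⟨⟨w, hwi⟩, rfl⟩
  obtain ⟨t', ht'⟩ : ∃ t' : 𝓞 K, algebraMap (𝓞 K) K t' = t := ⟨⟨t, hti⟩, rfl⟩
  let φ : Quart ℤ x y →+* 𝓞 K := lift w' t'
    (by
      apply RingOfIntegers.coe_injective
      simp only [map_pow, map_add, map_mul, map_ofNat, map_intCast, hw', ht', ht1])
    (by
      apply RingOfIntegers.coe_injective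
      simp only [map_pow, map_sub, map_mul, map_ofNat, map_intCast, map_one, hw', ht', ht2])
  have hφ : ∀ a, algebraMap (𝓞 K) K (φ a) = a.r0 + a.r1 * w + a.r2 * t + a.r3 * (w * t) := by
    intro a
    simp only [φ, lift_apply, map_add, map_mul, map_intCast, hw', ht']
  have hinj : Function.Injective φ := by
    rw [injective_iff_map_eq_zero]
    intro a ha
    have h0 : (a.r0 + a.r1 * w + a.r2 * t + a.r3 * (w * t) : K) = 0 := by rw [← hφ, ha, map_zero]
    let g : ℚ[X] := C (a.r3 / 2 : ℚ) * X ^ 3 + C (a.r2 / 2 : ℚ) * X ^ 2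
      + C (a.r1 - 3 * x * a.r3 / 2 : ℚ) * X + C (a.r0 - 3 * x * a.r2 / 2 : ℚ)
    have hg : AdjoinRoot.mk (poly x y ℚ) g = 0 := by
      rw [← AdjoinRoot.aeval_eq]
      simp [g]
      simp only [t] at h0
      linear_combination h0
    rw [AdjoinRoot.mk_eq_zero] at hg
    have hg0 : g = 0 := by
      refine eq_zero_of_dvd_of_natDegree_lt hg ?_
      rw [poly_natDegree]
      have : g.natDegree ≤ 3 := by simp only [g]; compute_degree
      omega
    have c0 := congrArg (coeff · 0) hg0
    have c1 := congrArg (coeff · 1) hg0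
    have c2 := congrArg (coeff · 2) hg0
    have c3 := congrArg (coeff · 3) hg0
    simp [g, coeff_X, coeff_C, coeff_X_pow, -map_sub, -map_mul, -map_div₀] at c0 c1 c2 c3
    simp [c2, c3] at c0 c1
    ext <;> simp [*]
  have hplaces : Fintype.card (InfinitePlace K) ≤ 3 := by
    have h1 := InfinitePlace.card_add_two_mul_card_eq_rank K
    have h2 := InfinitePlace.card_eq_nrRealPlaces_add_nrComplexPlaces (K := K)
    have h3 : 0 < InfinitePlace.nrComplexPlaces K := by
      obtain ⟨z, hz, hzi⟩ := hc
      let ψ : K →+* ℂ := AdjoinRoot.lift (algebraMap ℚ ℂ) z (by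
        rw [poly_eval₂, hz])
      classical
      rw [InfinitePlace.nrComplexPlaces, Fintype.card_pos_iff]
      refine ⟨⟨InfinitePlace.mk ψ, ?_⟩⟩
      rw [InfinitePlace.isComplex_mk_iff]
      intro hreal
      have := (ComplexEmbedding.isReal_iff.1 hreal)
      have h4 := RingHom.congr_fun this w
      have h5 : ψ w = z := AdjoinRoot.lift_root _
      rw [ComplexEmbedding.conjugate_coe_eq, h5] at h4
      exact hzi (Complex.conj_eq_iff_im.1 h4)
    omega
  have hrank : Units.rank K ≤ 2 := by unfold Units.rank; omega
  obtain ⟨r, hr⟩ := hr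
  exact exists_coord_aux x y K φ hinj hrank
    (AdjoinRoot.lift (algebraMap ℚ ℝ) r (by rw [poly_eval₂, hr]))

end Quart

namespace Quart

variable {x y : ℤ}

/-- Up to sign, every unit is a product of powers of `e₁` and `e₂` times an `N`-th power. -/
def Saturated (e₁ e₂ : (Quart ℤ x y)ˣ) (N : ℕ) : Prop :=
  ∀ α : (Quart ℤ x y)ˣ, ∃ (s η : (Quart ℤ x y)ˣ) (a b : ℕ),
    (s = 1 ∨ s = -1) ∧ α = s * e₁ ^ a * e₂ ^ b * η ^ N

lemma sign_mul_pow {G : Type*} [CommGroup G] [HasDistribNeg G] {s t : G} (hs : s = 1 ∨ s = -1)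
    (ht : t = 1 ∨ t = -1) (n : ℕ) : s * t ^ n = 1 ∨ s * t ^ n = -1 := by
  rcases ht with rfl | rfl
  · simpa using hs
  · rcases neg_one_pow_eq_or G n with h | h <;> rcases hs with rfl | rfl <;> simp [h]

lemma Saturated.mul {e₁ e₂ : (Quart ℤ x y)ˣ} {m n : ℕ} (hm : Saturated e₁ e₂ m)
    (hn : Saturated e₁ e₂ n) : Saturated e₁ e₂ (m * n) := by
  intro α
  obtain ⟨s, η, a, b, hs, rfl⟩ := hm α
  obtain ⟨s', η', a', b', hs', rfl⟩ := hn η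
  refine ⟨s * s' ^ m, η', a + a' * m, b + b' * m, sign_mul_pow hs hs' m, ?_⟩
  simp only [mul_pow, pow_add, ← pow_mul, mul_comm n m]
  simp only [mul_assoc, mul_left_comm]

lemma saturated_one (e₁ e₂ : (Quart ℤ x y)ˣ) : Saturated e₁ e₂ 1 :=
  fun α => ⟨1, α, 0, 0, .inl rfl, by simp⟩

lemma Saturated.pow {e₁ e₂ : (Quart ℤ x y)ˣ} {m : ℕ} (hm : Saturated e₁ e₂ m) (k : ℕ) :
    Saturated e₁ e₂ (m ^ k) := by
  induction k with
  | zero => simpa using saturated_one e₁ e₂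
  | succ k ih => rw [pow_succ]; exact ih.mul hm

/-- Independence modulo `l`-th powers implies saturation, as the unit rank is at most two. -/
lemma saturated_of_indep {r : ℕ} (hr : r ≤ 2) (g : Additive (Quart ℤ x y)ˣ →+ (Fin r → ℤ))
    (hg : Function.Surjective g)
    (hker : ∀ u : (Quart ℤ x y)ˣ, g (.ofMul u) = 0 → u = 1 ∨ u = -1)
    {e₁ e₂ : (Quart ℤ x y)ˣ} {l : ℕ} (hl : 0 < l)
    (hind : ∀ i < l, ∀ j < l, ∀ s η : (Quart ℤ x y)ˣ, (s = 1 ∨ s = -1) →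
      e₁ ^ i * e₂ ^ j = s * η ^ l → i = 0 ∧ j = 0) : Saturated e₁ e₂ l := by
  have : NeZero l := ⟨hl.ne'⟩
  have key : ∀ u v : (Quart ℤ x y)ˣ,
      (∀ k, (g (.ofMul u) k : ZMod l) = (g (.ofMul v) k : ZMod l)) →
      ∃ s η : (Quart ℤ x y)ˣ, (s = 1 ∨ s = -1) ∧ u = s * v * η ^ l := by
    intro u v h
    have h1 : ∀ k, ∃ c : ℤ, g (.ofMul u) k - g (.ofMul v) k = l * c := fun k =>
      (ZMod.intCast_zmod_eq_zero_iff_dvd _ l).1 (by push_cast; rw [h k, sub_self])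
    choose c hc using h1
    obtain ⟨η, hη⟩ : ∃ η : (Quart ℤ x y)ˣ, g (.ofMul η) = c := hg c
    refine ⟨u * v⁻¹ * (η ^ l)⁻¹, η, hker _ ?_, by
      rw [mul_right_comm, inv_mul_cancel_right, inv_mul_cancel_right]⟩
    ext k
    simp only [ofMul_mul, ofMul_inv, ofMul_pow, map_add, map_neg, map_nsmul, hη, Pi.add_apply,
      Pi.neg_apply, Pi.zero_apply, nsmul_eq_mul]
    have : ((l : Fin r → ℤ) * c) k = l * c k := rfl
    linear_combination hc k - this
  let f : Fin l × Fin l → Fin r → ZMod l := fun p k => (g (.ofMul (e₁ ^ p.1.1 * e₂ ^ p.2.1)) k : ℤ)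
  have hf : Function.Injective f := by
    rintro ⟨i, j⟩ ⟨i', j'⟩ h
    obtain ⟨s, η, hs, h⟩ := key _ _ (fun k => congrFun h k)
    simp only at h
    have cancel : ∀ (a b : ℕ), a < l → b < l → ∃ m d, a + (l - b) = l * m + d ∧ d < l ∧
        (d = 0 → a = b) := by
      intro a b ha hb
      refine ⟨(a + (l - b)) / l, (a + (l - b)) % l, (Nat.div_add_mod _ _).symm,
        Nat.mod_lt _ hl, fun h0 => ?_⟩
      obtain ⟨c, hc⟩ := Nat.dvd_of_mod_eq_zero h0
      have h1 : c = 1 := by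
        have : 0 < c := by
          rcases Nat.eq_zero_or_pos c with rfl | h
          · omega
          · exact h
        have : c < 2 := by
          by_contra h2
          have : l * 2 ≤ l * c := Nat.mul_le_mul_left l (by omega)
          omega
        omega
      subst h1; omega
    obtain ⟨m, d, hd, hdl, hd0⟩ := cancel i i' i.2 i'.2
    obtain ⟨m', d', hd', hdl', hd0'⟩ := cancel j j' j.2 j'.2
    have e1 : e₁ ^ i.1 * e₁ ^ (l - i'.1) = (e₁ ^ m) ^ l * e₁ ^ d := by
      rw [← pow_add, hd, pow_add, pow_mul']
    have e2 : e₂ ^ j.1 * e₂ ^ (l - j'.1) = (e₂ ^ m') ^ l * e₂ ^ d' := by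
      rw [← pow_add, hd', pow_add, pow_mul']
    have e3 : e₁ ^ i'.1 * e₁ ^ (l - i'.1) = e₁ ^ l := by
      rw [← pow_add, Nat.add_sub_cancel' i'.2.le]
    have e4 : e₂ ^ j'.1 * e₂ ^ (l - j'.1) = e₂ ^ l := by
      rw [← pow_add, Nat.add_sub_cancel' j'.2.le]
    have h2 : e₁ ^ d * e₂ ^ d' = s * (η * e₁ * e₂ * (e₁ ^ m)⁻¹ * (e₂ ^ m')⁻¹) ^ l := by
      have : ((e₁ ^ m) ^ l * e₁ ^ d) * ((e₂ ^ m') ^ l * e₂ ^ d') =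
          s * η ^ l * e₁ ^ l * e₂ ^ l := by
        rw [← e1, ← e2, ← e3, ← e4]
        calc _ = (e₁ ^ i.1 * e₂ ^ j.1) * (e₁ ^ (l - i'.1) * e₂ ^ (l - j'.1)) := by
              rw [mul_mul_mul_comm]
          _ = _ := by rw [h]; simp only [mul_assoc, mul_left_comm]
      simp only [mul_pow, inv_pow]
      rw [← mul_assoc, ← mul_assoc, eq_mul_inv_iff_mul_eq, eq_mul_inv_iff_mul_eq,
        ← mul_assoc, ← mul_assoc, ← this]
      simp only [mul_assoc, mul_left_comm, mul_comm]
    obtain ⟨h3, h4⟩ := hind d hdl d' hdl' _ _ hs h2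
    exact Prod.ext (Fin.ext (hd0 h3)) (Fin.ext (hd0' h4))
  have hbij : Function.Bijective f := by
    refine hf.bijective_of_nat_card_le ?_
    simp only [Nat.card_eq_fintype_card, Fintype.card_fun, ZMod.card, Fintype.card_fin,
      Fintype.card_prod, ← pow_two]
    exact Nat.pow_le_pow_right hl hr
  intro α
  obtain ⟨⟨i, j⟩, hij⟩ := hbij.2 (fun k => (g (.ofMul α) k : ZMod l))
  obtain ⟨s, η, hs, h⟩ := key α (e₁ ^ i.1 * e₂ ^ j.1) (fun k => (congrFun hij k).symm)
  exact ⟨s, η, i, j, hs, by rw [h, ← mul_assoc s]⟩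

/-- The value of an element under `ω ↦ w`, `τ ↦ t`. -/
def evalInt (w t : ℤ) (a : Quart ℤ x y) : ℤ := a.r0 + a.r1 * w + a.r2 * t + a.r3 * (w * t)

/-- `ω ↦ w`, `τ ↦ t` defines a character modulo `q` mapping `e₁` and `e₂` to elements whose
`(q - 1) / l`-th powers are `a` and `b`. -/
def charCheck (l q : ℕ) (w t : ℤ) (e₁ e₂ : Quart ℤ x y) (a b : ℕ) : Bool :=
  decide (l * ((q - 1) / l) = q - 1) && decide (2 ∣ (q - 1) / l) &&
  decide ((q : ℤ) ∣ w ^ 2 - (2 * t + 3 * x)) &&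
  decide ((q : ℤ) ∣ t ^ 2 - (3 * x ^ 2 - 1 - y * w)) &&
  decide ((q : ℤ) ∣ evalInt w t e₁ ^ ((q - 1) / l) - a) &&
  decide ((q : ℤ) ∣ evalInt w t e₂ ^ ((q - 1) / l) - b)

lemma charCheck_spec {l q : ℕ} [Fact q.Prime] {w t : ℤ} {e₁ e₂ : (Quart ℤ x y)ˣ} {a b : ℕ}
    (h : charCheck l q w t e₁.1 e₂.1 a b = true) {i j : ℕ} {s η : (Quart ℤ x y)ˣ}
    (hs : s = 1 ∨ s = -1) (he : e₁ ^ i * e₂ ^ j = s * η ^ l) :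
    a ^ i * b ^ j % q = 1 := by
  simp only [charCheck, Bool.and_eq_true, decide_eq_true_eq] at h
  obtain ⟨⟨⟨⟨⟨hm, he2⟩, h1⟩, h2⟩, h3⟩, h4⟩ := h
  set m := (q - 1) / l
  rw [← ZMod.intCast_zmod_eq_zero_iff_dvd, Int.cast_sub, sub_eq_zero] at h1 h2 h3 h4
  push_cast at h1 h2 h3 h4
  let χ : Quart ℤ x y →+* ZMod q := lift (w : ZMod q) t h1 h2
  have hχ : ∀ a : Quart ℤ x y, χ a = (evalInt w t a : ZMod q) := by
    intro a; simp [χ, lift_apply, evalInt]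
  rw [← hχ] at h3 h4
  have h5 := congrArg (fun u : (Quart ℤ x y)ˣ => χ u ^ m) he
  simp only [Units.val_mul, Units.val_pow_eq_pow_val, map_mul, map_pow, mul_pow] at h5
  rw [pow_right_comm, h3, pow_right_comm, h4, ← pow_mul, hm, ZMod.pow_card_sub_one_eq_one
    (((η.isUnit.map χ)).ne_zero), mul_one] at h5
  have h6 : χ s ^ m = 1 := by
    obtain ⟨c, hc⟩ := he2
    rw [hc]
    rcases hs with rfl | rfl <;> simp [pow_mul]
  rw [h6] at h5
  have h7 : ((a ^ i * b ^ j : ℕ) : ZMod q) = ((1 : ℕ) : ZMod q) := by exact_mod_cast h5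
  rw [ZMod.natCast_eq_natCast_iff'] at h7
  rw [h7, Nat.mod_eq_of_lt (Fact.out : q.Prime).one_lt]

/-- Two characters separate the `l ^ 2` products of powers of `e₁` and `e₂`. -/
def sepCheck (l q₁ a₁ b₁ q₂ a₂ b₂ : ℕ) : Bool :=
  (List.range l).all fun i => (List.range l).all fun j =>
    (a₁ ^ i * b₁ ^ j % q₁ != 1) || (a₂ ^ i * b₂ ^ j % q₂ != 1) || (i == 0 && j == 0)

lemma saturated_of_check {r : ℕ} (hr : r ≤ 2) (g : Additive (Quart ℤ x y)ˣ →+ (Fin r → ℤ))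
    (hg : Function.Surjective g)
    (hker : ∀ u : (Quart ℤ x y)ˣ, g (.ofMul u) = 0 → u = 1 ∨ u = -1)
    {e₁ e₂ : (Quart ℤ x y)ˣ} {l : ℕ} (hl : 0 < l) {q₁ q₂ : ℕ} (hq₁ : q₁.Prime) (hq₂ : q₂.Prime)
    {w₁ t₁ w₂ t₂ : ℤ} {a₁ b₁ a₂ b₂ : ℕ} (h₁ : charCheck l q₁ w₁ t₁ e₁.1 e₂.1 a₁ b₁ = true)
    (h₂ : charCheck l q₂ w₂ t₂ e₁.1 e₂.1 a₂ b₂ = true)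
    (h : sepCheck l q₁ a₁ b₁ q₂ a₂ b₂ = true) : Saturated e₁ e₂ l := by
  have := Fact.mk hq₁
  have := Fact.mk hq₂
  refine saturated_of_indep hr g hg hker hl fun i hi j hj s η hs he => ?_
  have h3 := List.all_eq_true.1 (List.all_eq_true.1 h i (List.mem_range.2 hi)) j
    (List.mem_range.2 hj)
  simpa [charCheck_spec h₁ hs he, charCheck_spec h₂ hs he] using h3

/-- The quartic form attached to the point `(x, y)`. -/
def form (x y u v : ℤ) : ℤ :=
  u ^ 4 - 6 * x * u ^ 2 * v ^ 2 + 4 * y * u * v ^ 3 + (4 - 3 * x ^ 2) * v ^ 4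

/-- The sextic covariant of `form x y`. -/
def sextic (x y u v : ℤ) : ℤ :=
  y * u ^ 6 + (4 - 12 * x ^ 2) * u ^ 5 * v + 15 * x * y * u ^ 4 * v ^ 2 - 10 * y ^ 2 * u ^ 3 * v ^ 3
    - 5 * y * (4 - 3 * x ^ 2) * u ^ 2 * v ^ 4
    + (6 * x * y ^ 2 + 9 * x ^ 2 * (4 - 3 * x ^ 2) - (4 - 3 * x ^ 2) ^ 2) * u * v ^ 5
    - (3 * x * y * (4 - 3 * x ^ 2) + 2 * y ^ 3) * v ^ 6

/-- The element `u - v * ω`. -/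
def lin (x y u v : ℤ) : Quart ℤ x y := ⟨u, -v, 0, 0⟩

lemma lin_mul (u v : ℤ) : lin x y u v * ⟨u ^ 3 - 3 * x * u * v ^ 2 + 4 * y * v ^ 3,
    u ^ 2 * v - 3 * x * v ^ 3, 2 * u * v ^ 2, 2 * v ^ 3⟩ = (form x y u v : Quart ℤ x y) := by
  ext <;> simp only [mul_r0, mul_r1, mul_r2, mul_r3, lin, form, intCast_r0, intCast_r1, intCast_r2,
    intCast_r3, Int.cast_id] <;> ring

lemma exists_unit_of_form_eq_one {u v : ℤ} (h : form x y u v = 1) :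
    ∃ α : (Quart ℤ x y)ˣ, (α : Quart ℤ x y) = lin x y u v := by
  have := lin_mul (x := x) (y := y) u v
  rw [h, Int.cast_one] at this
  exact ⟨⟨_, _, this, by rw [mul_comm]; exact this⟩, rfl⟩

lemma intCast_mul_r0 (n : ℤ) (a : Quart ℤ x y) : ((n : Quart ℤ x y) * a).r0 = n * a.r0 := by
  simp [mul_r0]
lemma intCast_mul_r1 (n : ℤ) (a : Quart ℤ x y) : ((n : Quart ℤ x y) * a).r1 = n * a.r1 := by
  simp [mul_r1]
lemma intCast_mul_r2 (n : ℤ) (a : Quart ℤ x y) : ((n : Quart ℤ x y) * a).r2 = n * a.r2 := by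
  simp [mul_r2]
lemma intCast_mul_r3 (n : ℤ) (a : Quart ℤ x y) : ((n : Quart ℤ x y) * a).r3 = n * a.r3 := by
  simp [mul_r3]

lemma intCast_dvd_iff (n : ℤ) (a : Quart ℤ x y) :
    (n : Quart ℤ x y) ∣ a ↔ n ∣ a.r0 ∧ n ∣ a.r1 ∧ n ∣ a.r2 ∧ n ∣ a.r3 := by
  constructor
  · rintro ⟨b, rfl⟩
    simp only [intCast_mul_r0, intCast_mul_r1, intCast_mul_r2, intCast_mul_r3, dvd_mul_right,
      and_self]
  · rintro ⟨⟨b0, h0⟩, ⟨b1, h1⟩, ⟨b2, h2⟩, ⟨b3, h3⟩⟩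
    refine ⟨⟨b0, b1, b2, b3⟩, ?_⟩
    ext <;> simp only [intCast_mul_r0, intCast_mul_r1, intCast_mul_r2, intCast_mul_r3, *]

/-- Reduction modulo `p`. -/
def red (p : ℕ) (x y : ℤ) : Quart ℤ x y →+* Quart (ZMod p) x y where
  toFun a := ⟨a.r0, a.r1, a.r2, a.r3⟩
  map_one' := by ext <;> simp
  map_zero' := by ext <;> simp
  map_add' a b := by ext <;> simp
  map_mul' a b := by ext <;> simp [mul_r0, mul_r1, mul_r2, mul_r3]

lemma red_eq_iff (p : ℕ) (a b : Quart ℤ x y) :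
    red p x y a = red p x y b ↔ ((p : ℤ) : Quart ℤ x y) ∣ b - a := by
  rw [intCast_dvd_iff, Quart.ext_iff]
  simp [red, ZMod.intCast_eq_intCast_iff_dvd_sub]

/-- Multiplication followed by reduction of the coordinates modulo `p`. -/
def mulMod (p : ℤ) (a b : Quart ℤ x y) : Quart ℤ x y :=
  ⟨(a.r0 * b.r0 + 3 * x * (a.r1 * b.r1) + (3 * (x * x) - 1) * (a.r2 * b.r2
      + 2 * (a.r1 * b.r3 + a.r3 * b.r1) + 3 * x * (a.r3 * b.r3))
      - 3 * x * y * (a.r2 * b.r3 + a.r3 * b.r2)) % p,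
    (a.r0 * b.r1 + a.r1 * b.r0 - y * (a.r2 * b.r2 + 2 * (a.r1 * b.r3 + a.r3 * b.r1)
      + 3 * x * (a.r3 * b.r3)) + (3 * (x * x) - 1) * (a.r2 * b.r3 + a.r3 * b.r2)) % p,
    (a.r0 * b.r2 + a.r2 * b.r0 + 2 * (a.r1 * b.r1) + 3 * x * (a.r1 * b.r3 + a.r3 * b.r1)
      - 2 * y * (a.r2 * b.r3 + a.r3 * b.r2) + 2 * (3 * (x * x) - 1) * (a.r3 * b.r3)) % p,
    (a.r0 * b.r3 + a.r3 * b.r0 + a.r1 * b.r2 + a.r2 * b.r1 - 2 * y * (a.r3 * b.r3)) % p⟩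

lemma dvd_mulMod_sub (p : ℤ) (a b : Quart ℤ x y) : (p : Quart ℤ x y) ∣ a * b - mulMod p a b := by
  rw [intCast_dvd_iff]
  simp only [sub_r0, sub_r1, sub_r2, sub_r3, mulMod, mul_r0, mul_r1, mul_r2, mul_r3, Int.cast_id]
  have key : ∀ a b : ℤ, a = b → p ∣ a - b % p := by
    rintro a b rfl
    exact Int.dvd_self_sub_emod
  refine ⟨key _ _ ?_, key _ _ ?_, key _ _ ?_, key _ _ ?_⟩ <;> ring

lemma red_mulMod (p : ℕ) (a b : Quart ℤ x y) :
    red p x y (mulMod p a b) = red p x y a * red p x y b := by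
  rw [← map_mul, red_eq_iff]; exact dvd_mulMod_sub _ _ _

/-- Powers with reduced coordinates. -/
def powMod (p : ℤ) (a : Quart ℤ x y) : ℕ → Quart ℤ x y
  | 0 => 1
  | n + 1 => mulMod p (powMod p a n) a

lemma red_powMod (p : ℕ) (a : Quart ℤ x y) (n : ℕ) :
    red p x y (powMod p a n) = red p x y a ^ n := by
  induction n with
  | zero => simp [powMod]
  | succ n ih => rw [powMod, red_mulMod, ih, pow_succ]

/-- Iterated `p`-th powers with reduced coordinates. -/
def frobMod (p : ℕ) (a : Quart ℤ x y) : ℕ → Quart ℤ x y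
  | 0 => a
  | n + 1 => powMod p (frobMod p a n) p

lemma red_frobMod (p : ℕ) (a : Quart ℤ x y) (n : ℕ) :
    red p x y (frobMod p a n) = red p x y a ^ p ^ n := by
  induction n with
  | zero => simp [frobMod]
  | succ n ih => rw [frobMod, red_powMod, ih, pow_succ, pow_mul]

/-- Congruence of all coordinates. -/
def congB (p : ℤ) (a b : Quart ℤ x y) : Bool :=
  ((b.r0 - a.r0) % p == 0) && ((b.r1 - a.r1) % p == 0) && ((b.r2 - a.r2) % p == 0) &&
    ((b.r3 - a.r3) % p == 0)

lemma congB_iff (p : ℤ) (a b : Quart ℤ x y) : congB p a b = true ↔ (p : Quart ℤ x y) ∣ b - a := by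
  rw [intCast_dvd_iff]
  simp only [congB, Bool.and_eq_true, beq_iff_eq, sub_r0, sub_r1, sub_r2, sub_r3, and_assoc,
    Int.dvd_iff_emod_eq_zero]

lemma congB_iff_red (p : ℕ) (a b : Quart ℤ x y) :
    congB p a b = true ↔ red p x y a = red p x y b := by
  rw [congB_iff, red_eq_iff]

/-- The `k`-th power of Frobenius is trivial modulo `p`. -/
def frobCheck (p k : ℕ) (x y : ℤ) : Bool :=
  congB p (frobMod p (⟨0, 1, 0, 0⟩ : Quart ℤ x y) k) ⟨0, 1, 0, 0⟩ &&
    congB p (frobMod p (⟨0, 0, 1, 0⟩ : Quart ℤ x y) k) ⟨0, 0, 1, 0⟩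

lemma red_unit_pow {p k : ℕ} [Fact p.Prime] (h : frobCheck p k x y = true) (η : (Quart ℤ x y)ˣ) :
    red p x y (η : Quart ℤ x y) ^ (p ^ k - 1) = 1 := by
  simp only [frobCheck, Bool.and_eq_true, congB_iff_red, red_frobMod] at h
  let ι : ZMod p →+* Quart (ZMod p) x y :=
    { toFun := fun a => ⟨a, 0, 0, 0⟩
      map_one' := rfl
      map_zero' := rfl
      map_add' := fun a b => by ext <;> simp
      map_mul' := fun a b => by ext <;> simp [mul_r0, mul_r1, mul_r2, mul_r3] }
  have hι : Function.Injective ι := fun a b h => congrArg Quart.r0 h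
  have : CharP (Quart (ZMod p) x y) p := charP_of_injective_ringHom hι p
  have hpow : ∀ a : ZMod p, ι a ^ p ^ k = ι a := fun a => by
    rw [← map_pow, ZMod.pow_card_pow]
  set w := red p x y ⟨0, 1, 0, 0⟩
  set t := red p x y ⟨0, 0, 1, 0⟩
  have hdec : ∀ a : Quart (ZMod p) x y,
      a = ι a.r0 + ι a.r1 * w + ι a.r2 * t + ι a.r3 * (w * t) := by
    intro a
    ext <;> simp [ι, w, t, red, mul_r0, mul_r1, mul_r2, mul_r3]
  have hfrob : ∀ a : Quart (ZMod p) x y, a ^ p ^ k = a := by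
    intro a
    conv_lhs => rw [hdec a]
    rw [add_pow_char_pow, add_pow_char_pow, add_pow_char_pow]
    simp only [mul_pow, hpow, h.1, h.2]
    exact (hdec a).symm
  have hu : IsUnit (red p x y (η : Quart ℤ x y)) := η.isUnit.map _
  have h1 := hfrob (red p x y (η : Quart ℤ x y))
  rw [← Nat.sub_add_cancel (Nat.one_le_pow k p (Fact.out : p.Prime).pos), pow_succ] at h1
  exact hu.mul_left_injective (by simpa using h1)

/-- Run a check along `c, c * e, c * e ^ 2, …`. -/
def loop (p : ℕ) (e : Quart ℤ x y) (chk : ℕ → Quart ℤ x y → Bool) :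
    ℕ → ℕ → Quart ℤ x y → Bool
  | 0, _, _ => true
  | n + 1, i, c => chk i c && loop p e chk n (i + 1) (mulMod p c e)

lemma loop_spec {p : ℕ} {e : Quart ℤ x y} {chk : ℕ → Quart ℤ x y → Bool} {n : ℕ} :
    ∀ {i : ℕ} {c : Quart ℤ x y}, loop p e chk n i c = true → ∀ m < n,
      ∃ c', red p x y c' = red p x y c * red p x y e ^ m ∧ chk (i + m) c' = true := by
  induction n with
  | zero => intro i c _ m hm; omega
  | succ n ih =>
    intro i c h m hm
    simp only [loop, Bool.and_eq_true] at h
    rcases m with _ | m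
    · exact ⟨c, by simp, h.1⟩
    · obtain ⟨c', h1, h2⟩ := ih h.2 m (by omega)
      refine ⟨c', ?_, by rw [← h2]; congr 1; omega⟩
      rw [h1, red_mulMod, pow_succ', mul_assoc]

/-- Neither `4 * g + 5` nor `-4 * g + 5` is a square modulo `p`. -/
def nonsquare (p : ℕ) (g : ℤ) : Bool :=
  (List.range p).all fun r => (((r : ℤ) * r - (4 * g + 5)) % p != 0) &&
    (((r : ℤ) * r - (-4 * g + 5)) % p != 0)

/-- The check for a residue class `± e₁ ^ i * e₂ ^ j`. -/
def classCheck (p : ℕ) (L : List (ℤ × ℤ)) (j i : ℕ) (c : Quart ℤ x y) : Bool :=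
  (!(c.r2 % p == 0 && c.r3 % p == 0) ||
    nonsquare p (sextic x y (c.r0 % p) (-c.r1 % p)) ||
    L.any fun s => congB p c (lin x y s.1 s.2) || congB p c (lin x y (-s.1) (-s.2))) &&
  (!(congB p c 1 || congB p c (-1)) || (i == 0 && j == 0))

/-- The check for all residue classes. -/
def tableCheck (p : ℕ) (L : List (ℤ × ℤ)) (n₁ n₂ : ℕ) (e₁ e₂ : Quart ℤ x y) : Bool :=
  loop p e₂ (fun j c => loop p e₁ (classCheck p L j) n₁ 0 c) n₂ 0 1

lemma tableCheck_spec {p : ℕ} {L : List (ℤ × ℤ)} {n₁ n₂ : ℕ} {e₁ e₂ : Quart ℤ x y}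
    (h : tableCheck p L n₁ n₂ e₁ e₂ = true) {i j : ℕ} (hi : i < n₁) (hj : j < n₂) :
    ∃ c, red p x y c = red p x y e₁ ^ i * red p x y e₂ ^ j ∧ classCheck p L j i c = true := by
  obtain ⟨c, h1, h2⟩ := loop_spec h j hj
  obtain ⟨c', h3, h4⟩ := loop_spec h2 i hi
  refine ⟨c', ?_, by simpa using h4⟩
  rw [h3, h1, map_one, one_mul, mul_comm]

lemma red_neg_one_ne_one {p : ℕ} [Fact p.Prime] (hp : p ≠ 2) : red p x y (-1) ≠ red p x y 1 := by
  intro h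
  rw [red_eq_iff, intCast_dvd_iff] at h
  have h1 : (p : ℤ) ∣ (2 : ℕ) := h.1
  exact hp ((Nat.prime_dvd_prime_iff_eq Fact.out Nat.prime_two).1 (Int.natCast_dvd_natCast.1 h1))

/-- Reduction modulo `p` of a unit, with exponents reduced modulo the orders. -/
lemma red_unit {p k : ℕ} [Fact p.Prime] (hf : frobCheck p k x y = true) {e₁ e₂ : (Quart ℤ x y)ˣ}
    {n₁ n₂ : ℕ} {s₁ s₂ : Quart ℤ x y} (hs₁ : s₁ = 1 ∨ s₁ = -1) (hs₂ : s₂ = 1 ∨ s₂ = -1)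
    (h₁ : red p x y e₁ ^ n₁ = red p x y s₁) (h₂ : red p x y e₂ ^ n₂ = red p x y s₂)
    {s η : (Quart ℤ x y)ˣ} (hs : s = 1 ∨ s = -1) (a b c : ℕ) :
    ∃ σ : Quart ℤ x y, (σ = 1 ∨ σ = -1) ∧
      red p x y ((s * e₁ ^ a * e₂ ^ b * η ^ ((p ^ k - 1) * c) : (Quart ℤ x y)ˣ) : Quart ℤ x y) =
        red p x y σ * (red p x y e₁ ^ (a % n₁) * red p x y e₂ ^ (b % n₂)) := by
  refine ⟨s * s₁ ^ (a / n₁) * s₂ ^ (b / n₂), ?_, ?_⟩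
  · have h3 : ((s : Quart ℤ x y) = 1 ∨ (s : Quart ℤ x y) = -1) := by
      rcases hs with rfl | rfl <;> simp
    rcases hs₁ with rfl | rfl <;> rcases hs₂ with rfl | rfl <;>
      rcases neg_one_pow_eq_or (Quart ℤ x y) (a / n₁) with h | h <;>
      rcases neg_one_pow_eq_or (Quart ℤ x y) (b / n₂) with h' | h' <;>
      rcases h3 with h3 | h3 <;> simp [h, h', h3]
  · have ha : red p x y e₁ ^ a = red p x y e₁ ^ (a % n₁) * red p x y s₁ ^ (a / n₁) := by
      conv_lhs => rw [← Nat.mod_add_div a n₁, pow_add, pow_mul, h₁]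
    have hb : red p x y e₂ ^ b = red p x y e₂ ^ (b % n₂) * red p x y s₂ ^ (b / n₂) := by
      conv_lhs => rw [← Nat.mod_add_div b n₂, pow_add, pow_mul, h₂]
    simp only [Units.val_mul, Units.val_pow_eq_pow_val, map_mul, map_pow, pow_mul,
      red_unit_pow hf, one_pow, mul_one, ha, hb]
    ring

lemma form_neg (x y u v : ℤ) : form x y (-u) (-v) = form x y u v := by simp only [form]; ring

lemma sextic_neg (x y u v : ℤ) : sextic x y (-u) (-v) = sextic x y u v := by
  simp only [sextic]; ring

lemma lin_neg (u v : ℤ) : lin x y (-u) (-v) = -lin x y u v := by ext <;> simp [lin]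

lemma sextic_modEq {p u v u' v' : ℤ} (hu : u ≡ u' [ZMOD p]) (hv : v ≡ v' [ZMOD p]) :
    sextic x y u v ≡ sextic x y u' v' [ZMOD p] := by
  simp only [sextic]; gcongr

lemma nonsquare_spec {p : ℕ} (hp : 0 < p) {g t : ℤ} (h : nonsquare p g = true) :
    ¬ (t ^ 2 ≡ 4 * g + 5 [ZMOD p] ∨ t ^ 2 ≡ -4 * g + 5 [ZMOD p]) := by
  have hp' : (0 : ℤ) < p := by exact_mod_cast hp
  obtain ⟨r, hr⟩ := Int.eq_ofNat_of_zero_le (Int.emod_nonneg t hp'.ne')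
  have hlt : r < p := by
    have := Int.emod_lt_of_pos t hp'
    omega
  have h1 := List.all_eq_true.1 h r (List.mem_range.2 hlt)
  simp only [Bool.and_eq_true, bne_iff_ne] at h1
  have h2 : (r : ℤ) ≡ t [ZMOD p] := by rw [← hr]; exact Int.mod_modEq t p
  have h3 : (r : ℤ) * r ≡ t ^ 2 [ZMOD p] := by rw [sq]; exact h2.mul h2
  rintro (h4 | h4)
  · exact h1.1 (Int.emod_eq_emod_iff_emod_sub_eq_zero.1 (h3.trans h4))
  · exact h1.2 (Int.emod_eq_emod_iff_emod_sub_eq_zero.1 (h3.trans h4))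

lemma exists_red_eq_of_tableCheck {p k : ℕ} [Fact p.Prime] (hf : frobCheck p k x y = true)
    {e₁ e₂ : (Quart ℤ x y)ˣ} {n₁ n₂ : ℕ} {s₁ s₂ : Quart ℤ x y} (hs₁ : s₁ = 1 ∨ s₁ = -1)
    (hs₂ : s₂ = 1 ∨ s₂ = -1) (h₁ : red p x y e₁ ^ n₁ = red p x y s₁)
    (h₂ : red p x y e₂ ^ n₂ = red p x y s₂) (hn₁ : 0 < n₁) (hn₂ : 0 < n₂)
    (hS : Saturated e₁ e₂ (p ^ k - 1)) {L : List (ℤ × ℤ)}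
    (hT : tableCheck p L n₁ n₂ e₁.1 e₂.1 = true) {u v t : ℤ} (huv : form x y u v = 1)
    (ht : t ^ 2 = 4 * sextic x y u v + 5 ∨ t ^ 2 = -4 * sextic x y u v + 5) :
    ∃ s ∈ L, red p x y (lin x y u v) = red p x y (lin x y s.1 s.2) ∨
      red p x y (lin x y (-u) (-v)) = red p x y (lin x y s.1 s.2) := by
  obtain ⟨α, hα⟩ := exists_unit_of_form_eq_one huv
  obtain ⟨s, η, a, b, hs, hαs⟩ := hS α
  obtain ⟨σ, hσ, hred⟩ := red_unit hf hs₁ hs₂ h₁ h₂ (η := η) hs a b 1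
  rw [mul_one, ← hαs, hα] at hred
  obtain ⟨c, hc, hcheck⟩ := tableCheck_spec hT (Nat.mod_lt a hn₁) (Nat.mod_lt b hn₂)
  rw [← hc] at hred
  have key : ∀ u v : ℤ, (t ^ 2 = 4 * sextic x y u v + 5 ∨ t ^ 2 = -4 * sextic x y u v + 5) →
      red p x y (lin x y u v) = red p x y c →
      ∃ s ∈ L, red p x y (lin x y u v) = red p x y (lin x y s.1 s.2) ∨
        red p x y (lin x y (-u) (-v)) = red p x y (lin x y s.1 s.2) := by
    intro u v ht hr
    simp only [classCheck, Bool.and_eq_true, Bool.or_eq_true] at hcheck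
    have hd := hr
    rw [red_eq_iff, intCast_dvd_iff] at hd
    simp only [lin, sub_r0, sub_r1, sub_r2, sub_r3, sub_zero, sub_neg_eq_add] at hd
    rcases hcheck.1 with (h | h) | h
    · simp [Int.dvd_iff_emod_eq_zero.1 hd.2.2.1, Int.dvd_iff_emod_eq_zero.1 hd.2.2.2] at h
    · exfalso
      have hu : c.r0 % p ≡ u [ZMOD p] :=
        (Int.mod_modEq _ _).trans (Int.modEq_iff_dvd.2 ((dvd_sub_comm).1 hd.1))
      have hv : -c.r1 % p ≡ v [ZMOD p] :=
        (Int.mod_modEq _ _).trans (Int.modEq_iff_dvd.2 (by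
          rw [sub_neg_eq_add, add_comm]; exact hd.2.1))
      have hg := (sextic_modEq (x := x) (y := y) hu hv).symm
      refine nonsquare_spec (Fact.out : p.Prime).pos h (t := t) ?_
      rcases ht with ht | ht <;> rw [ht]
      · exact .inl ((hg.mul_left 4).add_right 5)
      · exact .inr ((hg.mul_left (-4)).add_right 5)
    · obtain ⟨s, hsL, h⟩ := List.any_eq_true.1 h
      refine ⟨s, hsL, ?_⟩
      simp only [Bool.or_eq_true, congB_iff_red] at h
      rcases h with h | h
      · exact .inl (hr.trans h)
      · right
        rw [lin_neg, map_neg, hr, h, lin_neg, map_neg, neg_neg]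
  rcases hσ with rfl | rfl
  · rw [map_one, one_mul] at hred
    exact key u v ht hred
  · rw [map_neg, map_one, neg_one_mul] at hred
    obtain ⟨s, hs, h⟩ := key (-u) (-v) (by rwa [sextic_neg])
      (by rw [lin_neg, map_neg, hred, neg_neg])
    exact ⟨s, hs, by simpa [or_comm] using h⟩

lemma exists_one_add_pow {R : Type*} [CommRing R] (z : R) (n : ℕ) :
    ∃ c, (1 + z) ^ n = 1 + n * z + z ^ 2 * c := by
  induction n with
  | zero => exact ⟨0, by simp⟩
  | succ n ih =>
    obtain ⟨c, hc⟩ := ih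
    refine ⟨n + c + z * c, ?_⟩
    rw [pow_succ, hc]; push_cast; ring

/-- If `e = 1 + p * A` modulo `p ^ 2`, then `e ^ (p ^ j * n) = 1 + p ^ (j + 1) * n * A` modulo
`p ^ (j + 2)`. -/
lemma exists_pow_eq {R : Type*} [CommRing R] {p : ℕ} (hp : p.Prime) (hp2 : p ≠ 2) {e A : R}
    (he : (p : R) ^ 2 ∣ e - (1 + p * A)) (j n : ℕ) :
    ∃ c, e ^ (p ^ j * n) = 1 + p ^ (j + 1) * (n * A) + p ^ (j + 2) * c := by
  obtain ⟨d, hd⟩ := he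
  have h3 : 3 ≤ p := by have := hp.two_le; omega
  obtain ⟨z, hz⟩ := ZMod.exists_one_add_mul_pow_prime_pow_eq (u := (p : R)) (v := p) hp dvd_rfl
    (by rw [← pow_three']; exact pow_dvd_pow _ h3) (A + p * d) j
  have he : e = 1 + p * (A + p * d) := by linear_combination hd
  obtain ⟨c, hc⟩ := exists_one_add_pow ((p : R) ^ j * p * (A + p * d + p * z)) n
  refine ⟨n * (d + z) + p ^ j * (A + p * d + p * z) ^ 2 * c, ?_⟩
  rw [pow_mul, he, hz, hc]
  ring

lemma dvd_of_det {p a b u v u' v' : ℤ} (hp : Prime p) (hdet : ¬ p ∣ u * v' - v * u')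
    (h : p ∣ a * u + b * v) (h' : p ∣ a * u' + b * v') : p ∣ a ∧ p ∣ b := by
  constructor
  · refine (hp.dvd_or_dvd (?_ : p ∣ (u * v' - v * u') * a)).resolve_left hdet
    rw [show (u * v' - v * u') * a = v' * (a * u + b * v) - v * (a * u' + b * v') by ring]
    exact dvd_sub (h.mul_left _) (h'.mul_left _)
  · refine (hp.dvd_or_dvd (?_ : p ∣ (u * v' - v * u') * b)).resolve_left hdet
    rw [show (u * v' - v * u') * b = u * (a * u' + b * v') - u' * (a * u + b * v) by ring]
    exact dvd_sub (h'.mul_left _) (h.mul_left _)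

lemma pow_dvd_iff (p : ℕ) (n : ℕ) (a : Quart ℤ x y) :
    (p : Quart ℤ x y) ^ n ∣ a ↔ (p : ℤ) ^ n ∣ a.r0 ∧ (p : ℤ) ^ n ∣ a.r1 ∧ (p : ℤ) ^ n ∣ a.r2 ∧
      (p : ℤ) ^ n ∣ a.r3 := by
  rw [← intCast_dvd_iff]; push_cast; rfl

lemma natCast_mul_r2 (n : ℕ) (a : Quart ℤ x y) : ((n : Quart ℤ x y) * a).r2 = n * a.r2 := by
  simp [mul_r2]
lemma natCast_mul_r3 (n : ℕ) (a : Quart ℤ x y) : ((n : Quart ℤ x y) * a).r3 = n * a.r3 := by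
  simp [mul_r3]

lemma natCast_pow_mul_r2 (p n : ℕ) (a : Quart ℤ x y) :
    ((p : Quart ℤ x y) ^ n * a).r2 = p ^ n * a.r2 := by
  rw [← Nat.cast_pow, natCast_mul_r2, Nat.cast_pow]
lemma natCast_pow_mul_r3 (p n : ℕ) (a : Quart ℤ x y) :
    ((p : Quart ℤ x y) ^ n * a).r3 = p ^ n * a.r3 := by
  rw [← Nat.cast_pow, natCast_mul_r3, Nat.cast_pow]

/-- One step of Skolem's method: two elements without `τ`-coordinates that are congruent
modulo `p` are congruent modulo every power of `p`. -/
lemma pow_dvd_sub_of_eq {p : ℕ} (hp : p.Prime) (hp2 : p ≠ 2) {E₁ E₂ A B α β γ : Quart ℤ x y}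
    (h₁ : (p : Quart ℤ x y) ^ 2 ∣ E₁ - (1 + p * A)) (h₂ : (p : Quart ℤ x y) ^ 2 ∣ E₂ - (1 + p * B))
    (hα2 : α.r2 = 0) (hα3 : α.r3 = 0) (hβ2 : β.r2 = 0) (hβ3 : β.r3 = 0)
    (hdet : ¬ (p : ℤ) ∣ (β * A).r2 * (β * B).r3 - (β * B).r2 * (β * A).r3)
    {a b K : ℕ} (h : α = β * (E₁ ^ a * E₂ ^ b * (1 + p * γ) ^ p ^ K)) :
    (p : Quart ℤ x y) ^ (K + 1) ∣ α - β := by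
  obtain ⟨g, hg⟩ := exists_pow_eq hp hp2 (e := 1 + p * γ) (A := γ) (by simp) K 1
  rw [mul_one, Nat.cast_one, one_mul] at hg
  have hP : Prime (p : ℤ) := Nat.prime_iff_prime_int.1 hp
  have hind : ∀ j ≤ K, p ^ j ∣ a ∧ p ^ j ∣ b := by
    intro j hj
    induction j with
    | zero => simp
    | succ j ih =>
      obtain ⟨⟨a', rfl⟩, ⟨b', rfl⟩⟩ := ih (by omega)
      obtain ⟨c₁, hc₁⟩ := exists_pow_eq hp hp2 h₁ j a'
      obtain ⟨c₂, hc₂⟩ := exists_pow_eq hp hp2 h₂ j b'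
      obtain ⟨d, rfl⟩ : ∃ d, K = j + 1 + d := ⟨K - (j + 1), by omega⟩
      have hdvd : (p : Quart ℤ x y) ^ (j + 2) ∣
          (α - β) - p ^ (j + 1) * (a' * (β * A) + b' * (β * B)) := by
        rw [h, hc₁, hc₂, hg]
        refine ⟨β * (c₁ + c₂ + p ^ j * (a' * A + p * c₁) * (b' * B + p * c₂) + p ^ d * (γ + p * g) *
          (1 + p ^ (j + 1) * (a' * A) + p ^ (j + 2) * c₁) *
          (1 + p ^ (j + 1) * (b' * B) + p ^ (j + 2) * c₂)), ?_⟩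
        ring
      have hpow (z : ℤ) (hz : (p : ℤ) ^ (j + 2) ∣ 0 - p ^ (j + 1) * z) : (p : ℤ) ∣ z := by
        rw [zero_sub, dvd_neg, pow_succ _ (j + 1)] at hz
        exact Int.dvd_of_mul_dvd_mul_left (pow_ne_zero _ hP.ne_zero) hz
      rw [pow_dvd_iff] at hdvd
      have h2 := hdvd.2.2.1
      have h3 := hdvd.2.2.2
      rw [sub_r2, sub_r2, hα2, hβ2, sub_zero, natCast_pow_mul_r2, add_r2,
        natCast_mul_r2, natCast_mul_r2] at h2
      rw [sub_r3, sub_r3, hα3, hβ3, sub_zero, natCast_pow_mul_r3, add_r3,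
        natCast_mul_r3, natCast_mul_r3] at h3
      obtain ⟨h4, h5⟩ := dvd_of_det hP hdet (hpow _ h2) (hpow _ h3)
      rw [pow_succ]
      exact ⟨mul_dvd_mul_left _ (Int.natCast_dvd_natCast.1 h4),
        mul_dvd_mul_left _ (Int.natCast_dvd_natCast.1 h5)⟩
  obtain ⟨⟨a', rfl⟩, ⟨b', rfl⟩⟩ := hind K le_rfl
  obtain ⟨c₁, hc₁⟩ := exists_pow_eq hp hp2 h₁ K a'
  obtain ⟨c₂, hc₂⟩ := exists_pow_eq hp hp2 h₂ K b'
  rw [h, hc₁, hc₂, hg]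
  refine ⟨β * (a' * A + p * c₁ + (b' * B + p * c₂) * (1 + p ^ (K + 1) * (a' * A) + p ^ (K + 2) * c₁)
    + (γ + p * g) * (1 + p ^ (K + 1) * (a' * A) + p ^ (K + 2) * c₁) *
      (1 + p ^ (K + 1) * (b' * B) + p ^ (K + 2) * c₂)), ?_⟩
  ring

/-- A criterion for a unit `u - v * ω` to be determined by its residue class modulo `p`. -/
lemma eq_of_red_eq {p k : ℕ} [Fact p.Prime] (hp2 : p ≠ 2) (hf : frobCheck p k x y = true)
    {e₁ e₂ : (Quart ℤ x y)ˣ} {n₁ n₂ : ℕ} {s₁ s₂ A B : Quart ℤ x y} (hs₁ : s₁ = 1 ∨ s₁ = -1)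
    (hs₂ : s₂ = 1 ∨ s₂ = -1)
    (h₁ : (p : Quart ℤ x y) ^ 2 ∣ (e₁ : Quart ℤ x y) ^ n₁ - s₁ * (1 + p * A))
    (h₂ : (p : Quart ℤ x y) ^ 2 ∣ (e₂ : Quart ℤ x y) ^ n₂ - s₂ * (1 + p * B))
    (hn₁ : 0 < n₁) (hn₂ : 0 < n₂)
    (hS : Saturated e₁ e₂ (p ^ k - 1)) (hSp : Saturated e₁ e₂ p) {L : List (ℤ × ℤ)}
    (hT : tableCheck p L n₁ n₂ e₁.1 e₂.1 = true) {u v u' v' : ℤ} (huv : form x y u v = 1)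
    (huv' : form x y u' v' = 1)
    (hdet : ¬ (p : ℤ) ∣ (lin x y u' v' * A).r2 * (lin x y u' v' * B).r3 -
      (lin x y u' v' * B).r2 * (lin x y u' v' * A).r3)
    (hred : red p x y (lin x y u v) = red p x y (lin x y u' v')) : u = u' ∧ v = v' := by
  have hp : p.Prime := Fact.out
  have hredp (z : Quart ℤ x y) : red p x y (p * z) = 0 := by
    rw [map_mul, map_natCast]; ext <;> simp [mul_r0, mul_r1, mul_r2, mul_r3]
  have hE (e A s : Quart ℤ x y) (hs : s = 1 ∨ s = -1) (n : ℕ)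
      (h : (p : Quart ℤ x y) ^ 2 ∣ e ^ n - s * (1 + p * A)) :
      red p x y e ^ n = red p x y s := by
    obtain ⟨c, hc⟩ := h
    rw [← map_pow, eq_add_of_sub_eq hc, show (p : Quart ℤ x y) ^ 2 * c + s * (1 + p * A) =
      s + p * (p * c + s * A) by ring, map_add, hredp, add_zero]
  have hE' (e A s : Quart ℤ x y) (hs : s = 1 ∨ s = -1) (n : ℕ)
      (h : (p : Quart ℤ x y) ^ 2 ∣ e ^ n - s * (1 + p * A)) :
      (p : Quart ℤ x y) ^ 2 ∣ s * e ^ n - (1 + p * A) := by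
    have hss : s * s = 1 := by rcases hs with rfl | rfl <;> simp
    have := h.mul_left s
    rwa [mul_sub, ← mul_assoc, hss, one_mul] at this
  have hr₁ := hE _ _ _ hs₁ _ h₁
  have hr₂ := hE _ _ _ hs₂ _ h₂
  obtain ⟨α, hα⟩ := exists_unit_of_form_eq_one huv
  obtain ⟨β, hβ⟩ := exists_unit_of_form_eq_one huv'
  have hmain : ∀ K, (p : Quart ℤ x y) ^ (K + 1) ∣ lin x y u v - lin x y u' v' := by
    intro K
    obtain ⟨s, η, a, b, hs, hαβ⟩ := (hS.mul (hSp.pow K)) (α * β⁻¹)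
    obtain ⟨σ, hσ, hr⟩ := red_unit hf hs₁ hs₂ hr₁ hr₂ (η := η) hs a b (p ^ K)
    obtain ⟨c, hc, hcheck⟩ := tableCheck_spec hT (Nat.mod_lt a hn₁) (Nat.mod_lt b hn₂)
    have h1 : red p x y ((α * β⁻¹ : (Quart ℤ x y)ˣ) : Quart ℤ x y) = 1 := by
      rw [Units.val_mul, map_mul, hα, hred, ← hβ, ← map_mul, Units.mul_inv, map_one]
    rw [← hαβ, h1, ← hc] at hr
    have hc1 : congB p c 1 = true ∨ congB p c (-1) = true := by
      simp only [congB_iff_red, map_neg, map_one]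
      rcases hσ with rfl | rfl
      · left; simpa using hr.symm
      · right; rw [hr]; simp
    simp only [classCheck, Bool.and_eq_true (_ || _)] at hcheck
    have hz : a % n₁ = 0 ∧ b % n₂ = 0 := by
      rcases hc1 with hc1 | hc1 <;> simpa [hc1] using hcheck.2
    obtain ⟨a', rfl⟩ := Nat.dvd_of_mod_eq_zero hz.1
    obtain ⟨b', rfl⟩ := Nat.dvd_of_mod_eq_zero hz.2
    obtain ⟨γ, hγ⟩ : ∃ γ, (η : Quart ℤ x y) ^ (p ^ k - 1) = 1 + p * γ := by
      have h2 := red_unit_pow hf η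
      rw [← map_pow, ← map_one (red p x y), eq_comm, red_eq_iff] at h2
      obtain ⟨γ, h2⟩ := h2
      exact ⟨γ, by rw [sub_eq_iff_eq_add'] at h2; rw [h2]; push_cast; rfl⟩
    obtain ⟨τ, hτ, hτe⟩ : ∃ τ : Quart ℤ x y, (τ = 1 ∨ τ = -1) ∧
        lin x y u v = lin x y u' v' * τ * ((s₁ * e₁ ^ n₁) ^ a' * (s₂ * e₂ ^ n₂) ^ b' *
          (1 + p * γ) ^ p ^ K) := by
      refine ⟨s * s₁ ^ a' * s₂ ^ b', ?_, ?_⟩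
      · have h3 : ((s : Quart ℤ x y) = 1 ∨ (s : Quart ℤ x y) = -1) := by
          rcases hs with rfl | rfl <;> simp
        rcases hs₁ with rfl | rfl <;> rcases hs₂ with rfl | rfl <;>
          rcases neg_one_pow_eq_or (Quart ℤ x y) a' with h | h <;>
          rcases neg_one_pow_eq_or (Quart ℤ x y) b' with h' | h' <;>
          rcases h3 with h3 | h3 <;> simp [h, h', h3]
      · have hq₁ : s₁ * s₁ = 1 := by rcases hs₁ with rfl | rfl <;> simp
        have hq₂ : s₂ * s₂ = 1 := by rcases hs₂ with rfl | rfl <;> simp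
        have h4 : α = β * (s * e₁ ^ (n₁ * a') * e₂ ^ (n₂ * b') * η ^ ((p ^ k - 1) * p ^ K)) := by
          rw [← hαβ, mul_inv_cancel_comm_assoc]
        have h5 := congrArg Units.val h4
        simp only [Units.val_mul, Units.val_pow_eq_pow_val, pow_mul, hα, hβ, hγ] at h5
        rw [h5]
        have h6 : (s₁ * s₁) ^ a' * (s₂ * s₂) ^ b' = 1 := by rw [hq₁, hq₂]; simp
        simp only [mul_pow] at h6 ⊢
        linear_combination (-(lin x y u' v' * s * ((e₁ : Quart ℤ x y) ^ n₁) ^ a' *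
          ((e₂ : Quart ℤ x y) ^ n₂) ^ b' * (1 + p * γ) ^ p ^ K)) * h6
    have h7 : red p x y τ = 1 := by
      have h8 := congrArg (red p x y) hτe
      have h9 (s : Quart ℤ x y) (hs : s = 1 ∨ s = -1) : red p x y s * red p x y s = 1 := by
        rcases hs with rfl | rfl <;> simp
      have hu : IsUnit (red p x y (lin x y u' v')) := by rw [← hβ]; exact β.isUnit.map _
      simp only [map_mul, map_pow, hr₁, hr₂, h9 _ hs₁, h9 _ hs₂, map_add, hredp, map_one, add_zero,
        one_pow, mul_one, hred] at h8
      exact hu.mul_left_cancel (by rw [← h8, mul_one])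
    have h10 : τ = 1 := by
      refine hτ.resolve_right ?_
      rintro rfl
      exact red_neg_one_ne_one hp2 (by rw [h7, map_one])
    rw [h10, mul_one] at hτe
    exact pow_dvd_sub_of_eq hp hp2 (hE' _ _ _ hs₁ _ h₁)
      (hE' _ _ _ hs₂ _ h₂) rfl rfl rfl rfl hdet hτe
  have hzero (z : ℤ) (hz : ∀ K, (p : ℤ) ^ (K + 1) ∣ z) : z = 0 := by
    refine Int.eq_zero_of_dvd_of_natAbs_lt_natAbs (hz z.natAbs) ?_
    rw [Int.natAbs_pow, Int.natAbs_natCast]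
    exact (Nat.lt_pow_self hp.one_lt).trans (Nat.pow_lt_pow_right hp.one_lt (Nat.lt_succ_self _))
  constructor
  · exact sub_eq_zero.1 (hzero _ fun K => ((pow_dvd_iff _ _ _).1 (hmain K)).1)
  · have := hzero (-v - -v') fun K => ((pow_dvd_iff _ _ _).1 (hmain K)).2.1
    omega

end Quart

namespace Quart

lemma exists_root_of_sign {f : ℝ → ℝ} (hf : Continuous f) {a b : ℝ} (hab : a ≤ b) (ha : f a < 0)
    (hb : 0 < f b) : ∃ e, a < e ∧ e < b ∧ f e = 0 := by
  obtain ⟨e, ⟨h1, h2⟩, h3⟩ := intermediate_value_Icc hab hf.continuousOn ⟨ha.le, hb.le⟩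
  refine ⟨e, lt_of_le_of_ne h1 ?_, lt_of_le_of_ne h2 ?_, h3⟩
  · rintro rfl; exact ha.ne h3
  · rintro rfl; exact hb.ne' h3

lemma exists_root_pos : ∃ e : ℝ, -2.03 < e ∧ e < -2.02 ∧ 4 * e ^ 3 - 4 * e + 25 = 0 :=
  exists_root_of_sign (f := fun e => 4 * e ^ 3 - 4 * e + 25) (by fun_prop) (by norm_num)
    (by norm_num) (by norm_num)

lemma exists_root_neg : ∃ e : ℝ, 1.97 < e ∧ e < 1.98 ∧ 4 * e ^ 3 - 4 * e - 23 = 0 :=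
  exists_root_of_sign (f := fun e => 4 * e ^ 3 - 4 * e - 23) (by fun_prop) (by norm_num)
    (by norm_num) (by norm_num)

/-- Data of a factorization
`((u + σ * v) ^ 2 + Q * v ^ 2) * ((u - σ * v) ^ 2 - P * v ^ 2)` of the quartic form. -/
lemma exists_factorization {x y k e : ℝ} (he : 4 * e ^ 3 - 4 * e + k = 0)
    (hxy : y ^ 2 = 4 * x ^ 3 - 4 * x + k) (hex : e < x) (hy : y ≠ 0) (he2 : 4 < 3 * e ^ 2) :
    ∃ σ P Q : ℝ, 0 < P ∧ 0 < Q ∧ σ ^ 2 = x - e ∧ Q - P = 2 * σ ^ 2 - 6 * x ∧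
      σ * (P + Q) = -2 * y ∧ (σ ^ 2 + Q) * (σ ^ 2 - P) = 4 - 3 * x ^ 2 ∧ P * Q = 3 * e ^ 2 - 4 := by
  have hs : 0 < √(x - e) := Real.sqrt_pos.2 (sub_pos.2 hex)
  have hs2 : √(x - e) ^ 2 = x - e := Real.sq_sqrt (sub_pos.2 hex).le
  obtain ⟨σ, hσ, hσy⟩ : ∃ σ : ℝ, σ ^ 2 = x - e ∧ 0 < -2 * y / σ := by
    rcases lt_or_gt_of_ne hy with h | h
    · exact ⟨√(x - e), hs2, div_pos (by linarith) hs⟩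
    · exact ⟨-√(x - e), by rw [neg_sq, hs2], div_pos_of_neg_of_neg (by linarith) (by linarith)⟩
  have hσ0 : σ ≠ 0 := by rintro rfl; simp at hσy
  have hS : σ * (-2 * y / σ) = -2 * y := by field_simp
  set S := -2 * y / σ
  have hS2 : (x - e) * S ^ 2 = (x - e) * (4 * (4 * (x ^ 2 + x * e + e ^ 2 - 1))) := by
    have : (σ * S) ^ 2 = (-2 * y) ^ 2 := by rw [hS]
    linear_combination this - S ^ 2 * hσ + 4 * hxy + 4 * he
  have hS3 := mul_left_cancel₀ (sub_pos.2 hex).ne' hS2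
  have hPQ : (S - (2 * σ ^ 2 - 6 * x)) / 2 * ((S + (2 * σ ^ 2 - 6 * x)) / 2) = 3 * e ^ 2 - 4 := by
    rw [hσ]; linear_combination hS3 / 4
  have hpos : 0 < (S - (2 * σ ^ 2 - 6 * x)) / 2 ∧ 0 < (S + (2 * σ ^ 2 - 6 * x)) / 2 := by
    have h0 : 0 < (S - (2 * σ ^ 2 - 6 * x)) / 2 * ((S + (2 * σ ^ 2 - 6 * x)) / 2) := by
      rw [hPQ]; linarith
    rcases mul_pos_iff.1 h0 with h | h
    · exact h
    · linarith [h.1, h.2]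
  refine ⟨σ, _, _, hpos.1, hpos.2, hσ, by ring, by linear_combination hS, ?_, hPQ⟩
  rw [hσ] at hPQ ⊢
  linear_combination -hPQ

lemma factorization_eq {R : Type*} [CommRing R] {x y σ P Q : R} (h1 : Q - P = 2 * σ ^ 2 - 6 * x)
    (h2 : σ * (P + Q) = -2 * y) (h3 : (σ ^ 2 + Q) * (σ ^ 2 - P) = 4 - 3 * x ^ 2) (r : R) :
    r ^ 4 - 6 * x * r ^ 2 + 4 * y * r + (4 - 3 * x ^ 2) =
      ((r + σ) ^ 2 + Q) * ((r - σ) ^ 2 - P) := by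
  linear_combination -r ^ 2 * h1 + 2 * r * h2 - h3

lemma exists_roots {x y k e : ℝ} (he : 4 * e ^ 3 - 4 * e + k = 0)
    (hxy : y ^ 2 = 4 * x ^ 3 - 4 * x + k) (hex : e < x) (hy : y ≠ 0) (he2 : 4 < 3 * e ^ 2) :
    (∃ r : ℝ, r ^ 4 - 6 * x * r ^ 2 + 4 * y * r + (4 - 3 * x ^ 2) = 0) ∧
    ∃ z : ℂ, z ^ 4 - 6 * x * z ^ 2 + 4 * y * z + (4 - 3 * x ^ 2) = 0 ∧ z.im ≠ 0 := by
  obtain ⟨σ, P, Q, hP, hQ, hσ, h1, h2, h3, -⟩ := exists_factorization he hxy hex hy he2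
  refine ⟨⟨σ + √P, ?_⟩, ⟨-σ + √Q * Complex.I, ?_, by simpa using (Real.sqrt_pos.2 hQ).ne'⟩⟩
  · rw [factorization_eq h1 h2 h3, add_sub_cancel_left, Real.sq_sqrt hP.le, sub_self, mul_zero]
  · have h1' : (Q : ℂ) - P = 2 * σ ^ 2 - 6 * x := by exact_mod_cast h1
    have h2' : (σ : ℂ) * (P + Q) = -2 * y := by exact_mod_cast h2
    have h3' : ((σ : ℂ) ^ 2 + Q) * (σ ^ 2 - P) = 4 - 3 * x ^ 2 := by exact_mod_cast h3
    have hQ2 : (√Q : ℂ) ^ 2 = Q := by exact_mod_cast Real.sq_sqrt hQ.le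
    rw [factorization_eq h1' h2' h3', neg_add_cancel_comm, mul_pow, Complex.I_sq, hQ2]
    ring

lemma exists_real_root (x y k : ℤ) (hk : k = 25 ∨ k = -23) (hxy : y ^ 2 = 4 * x ^ 3 - 4 * x + k) :
    ∃ e : ℝ, 4 * e ^ 3 - 4 * e + k = 0 ∧ e < x ∧ 4 < 3 * e ^ 2 ∧
      (k = 25 ∧ -2.03 < e ∧ e < -2.02 ∨ k = -23 ∧ 1.97 < e ∧ e < 1.98) := by
  rcases hk with rfl | rfl
  · obtain ⟨e, h1, h2, h3⟩ := exists_root_pos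
    have hx : -2 ≤ x := by
      by_contra! h
      nlinarith [sq_nonneg y, sq_nonneg x]
    have hx' : (-2 : ℝ) ≤ x := by exact_mod_cast hx
    exact ⟨e, by push_cast; exact h3, by linarith, by nlinarith, .inl ⟨rfl, h1, h2⟩⟩
  · obtain ⟨e, h1, h2, h3⟩ := exists_root_neg
    have hx : 2 ≤ x := by
      by_contra! h
      rcases le_or_gt x (-1) with h' | h'
      · nlinarith [sq_nonneg y, sq_nonneg x]
      · have : 0 ≤ x := by omega
        interval_cases x <;> nlinarith [sq_nonneg y]
    have hx' : (2 : ℝ) ≤ x := by exact_mod_cast hx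
    exact ⟨e, by push_cast; linarith, by linarith, by nlinarith, .inr ⟨rfl, h1, h2⟩⟩

lemma odd_of_point {x y k : ℤ} (hk : k = 25 ∨ k = -23) (hxy : y ^ 2 = 4 * x ^ 3 - 4 * x + k) :
    Odd y := by
  rw [← Int.odd_pow' (two_ne_zero), hxy]
  rcases hk with rfl | rfl
  · exact ⟨2 * x ^ 3 - 2 * x + 12, by ring⟩
  · exact ⟨2 * x ^ 3 - 2 * x - 12, by ring⟩

/-- The coordinates on the unit group attached to a point of one of the two curves. -/
lemma exists_coord_of_point {x y k : ℤ} (hk : k = 25 ∨ k = -23)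
    (hxy : y ^ 2 = 4 * x ^ 3 - 4 * x + k) {q : ℕ} (hq : q.Prime)
    (h1 : ∀ a : ZMod q, a ^ 4 - 6 * x * a ^ 2 + 4 * y * a + (4 - 3 * x ^ 2) ≠ 0)
    (h2 : ∀ s z : ZMod q, s * (s ^ 2 - 6 * x - 2 * z) ≠ 4 * y ∨
      z * (s ^ 2 - 6 * x - z) ≠ 4 - 3 * x ^ 2) :
    ∃ r ≤ 2, ∃ g : Additive (Quart ℤ x y)ˣ →+ (Fin r → ℤ), Function.Surjective g ∧
      ∀ u : (Quart ℤ x y)ˣ, g (.ofMul u) = 0 → u = 1 ∨ u = -1 := by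
  obtain ⟨e, he, hex, he2, -⟩ := exists_real_root x y k hk hxy
  have := Fact.mk hq
  have hy : (y : ℝ) ≠ 0 := by
    have := odd_of_point hk hxy
    rintro h
    rw [Int.cast_eq_zero.1 h] at this
    simp at this
  have h := exists_roots he (by exact_mod_cast hxy) hex hy he2
  refine exists_coord x y (poly_irreducible x y q h1 h2) ?_ ?_
  · exact h.1
  · simpa using h.2

end Quart

namespace Quart

variable {x y : ℤ}

lemma exists_unit (a b : Quart ℤ x y) (h : a * b = 1) :
    ∃ e : (Quart ℤ x y)ˣ, (e : Quart ℤ x y) = a :=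
  ⟨⟨a, b, h, by rw [mul_comm]; exact h⟩, rfl⟩

/-- The congruence `e ^ n = s * (1 + p * A)` modulo `p ^ 2`. -/
def orderCheck (p n : ℕ) (e s A : Quart ℤ x y) : Bool :=
  congB ((p ^ 2 : ℕ) : ℤ) (powMod ((p ^ 2 : ℕ) : ℤ) e n) (s * (1 + p * A))

lemma orderCheck_spec {p n : ℕ} {e s A : Quart ℤ x y} (h : orderCheck p n e s A = true) :
    (p : Quart ℤ x y) ^ 2 ∣ e ^ n - s * (1 + p * A) := by
  rw [orderCheck, congB_iff_red, red_powMod, ← map_pow, red_eq_iff, dvd_sub_comm] at h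
  push_cast at h
  exact h

/-- The condition of Skolem's method at a solution. -/
def detCheck (p : ℕ) (A B : Quart ℤ x y) (s : ℤ × ℤ) : Bool :=
  form x y s.1 s.2 == 1 && ((lin x y s.1 s.2 * A).r2 * (lin x y s.1 s.2 * B).r3 -
      (lin x y s.1 s.2 * B).r2 * (lin x y s.1 s.2 * A).r3) % p != 0

theorem eq_of_checks {p k : ℕ} (hp : p.Prime) (hp2 : p ≠ 2) (hf : frobCheck p k x y = true)
    {e₁ e₂ : (Quart ℤ x y)ˣ} {n₁ n₂ : ℕ} {s₁ s₂ A B : Quart ℤ x y} (hs₁ : s₁ = 1 ∨ s₁ = -1)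
    (hs₂ : s₂ = 1 ∨ s₂ = -1) (h₁ : orderCheck p n₁ e₁.1 s₁ A = true)
    (h₂ : orderCheck p n₂ e₂.1 s₂ B = true) (hn₁ : 0 < n₁) (hn₂ : 0 < n₂)
    {N : ℕ} (hS : Saturated e₁ e₂ N) (hN : N = p ^ k - 1) {L : List (ℤ × ℤ)}
      (hSp : L = [] ∨ Saturated e₁ e₂ p)
    (hT : tableCheck p L n₁ n₂ e₁.1 e₂.1 = true) (hL : L.all (detCheck p A B) = true)
    (u v t : ℤ) (huv : form x y u v = 1)
    (ht : t ^ 2 = 4 * sextic x y u v + 5 ∨ t ^ 2 = -4 * sextic x y u v + 5) :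
    ∃ s ∈ L, (u = s.1 ∧ v = s.2) ∨ (-u = s.1 ∧ -v = s.2) := by
  have := Fact.mk hp
  subst hN
  have hr (e : Quart ℤ x y) (n : ℕ) (s A : Quart ℤ x y) (hs : s = 1 ∨ s = -1)
      (h : orderCheck p n e s A = true) : red p x y e ^ n = red p x y s := by
    obtain ⟨c, hc⟩ := orderCheck_spec h
    rw [← map_pow, red_eq_iff]
    exact ⟨-(p * c + s * A), by push_cast; linear_combination -hc⟩
  obtain ⟨s, hsL, hs⟩ := exists_red_eq_of_tableCheck hf hs₁ hs₂ (hr _ _ _ _ hs₁ h₁)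
    (hr _ _ _ _ hs₂ h₂) hn₁ hn₂ hS hT huv ht
  have hd := List.all_eq_true.1 hL s hsL
  simp only [detCheck, Bool.and_eq_true, beq_iff_eq, bne_iff_ne, ne_eq,
    ← Int.dvd_iff_emod_eq_zero] at hd
  have hSp' := hSp.resolve_left (List.ne_nil_of_mem hsL)
  refine ⟨s, hsL, hs.imp (fun h => ?_) (fun h => ?_)⟩
  · exact eq_of_red_eq hp2 hf hs₁ hs₂ (orderCheck_spec h₁) (orderCheck_spec h₂) hn₁ hn₂ hS hSp'
      hT huv hd.1 hd.2 h
  · exact eq_of_red_eq hp2 hf hs₁ hs₂ (orderCheck_spec h₁) (orderCheck_spec h₂) hn₁ hn₂ hS hSp'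
      hT (by rwa [form_neg]) hd.1 hd.2 h

end Quart

namespace Quart

theorem solutions_neg_two_one (u v t : ℤ) (huv : form (-2) 1 u v = 1)
    (ht : t ^ 2 = 4 * sextic (-2) 1 u v + 5 ∨ t ^ 2 = -4 * sextic (-2) 1 u v + 5) :
    (u = 1 ∧ v = 0) ∨ (-u = 1 ∧ -v = 0) ∨ (u = (-1) ∧ v = 1) ∨ (-u = (-1) ∧ -v = 1) := by
  obtain ⟨r, hr, g, hg, hker⟩ := exists_coord_of_point (x := -2) (y := 1) (k := 25)
    (by norm_num) (by norm_num) (q := 7) (by norm_num) (by decide +kernel) (by decide +kernel)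
  obtain ⟨e₁, he₁⟩ := exists_unit (⟨16949, 13250, 2708, 4120⟩ : Quart ℤ (-2) 1)
    ⟨117, -306, 84, -88⟩ (by ext <;> rfl)
  obtain ⟨e₂, he₂⟩ :=
    exists_unit (⟨4804787177121, -12691990993941, 3512463541328, -3670450933828⟩ : Quart ℤ (-2) 1)
    ⟨35211500852028401370947, 27526824527034210453299, 5625878716539801376818,
      8559310241200751010566⟩ (by ext <;> rfl)
  have hS2 : Saturated e₁ e₂ 2 :=
    saturated_of_check hr g hg hker (by norm_num) (q₁ := 13) (q₂ := 13)
    (by norm_num) (by norm_num) (w₁ := 8) (t₁ := 9) (w₂ := 10) (t₂ := 1)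
    (a₁ := 12) (b₁ := 12) (a₂ := 12) (b₂ := 1) (by rw [he₁, he₂]; decide +kernel)
    (by rw [he₁, he₂]; decide +kernel) (by decide +kernel)
  have hS3 : Saturated e₁ e₂ 3 :=
    saturated_of_check hr g hg hker (by norm_num) (q₁ := 13) (q₂ := 13)
    (by norm_num) (by norm_num) (w₁ := 8) (t₁ := 9) (w₂ := 10) (t₂ := 1)
    (a₁ := 3) (b₁ := 1) (a₂ := 1) (b₂ := 3) (by rw [he₁, he₂]; decide +kernel)
    (by rw [he₁, he₂]; decide +kernel) (by decide +kernel)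
  have hS5 : Saturated e₁ e₂ 5 :=
    saturated_of_check hr g hg hker (by norm_num) (q₁ := 41) (q₂ := 61)
    (by norm_num) (by norm_num) (w₁ := 31) (t₁ := 12) (w₂ := 23) (t₂ := 54)
    (a₁ := 16) (b₁ := 1) (a₂ := 20) (b₂ := 34) (by rw [he₁, he₂]; decide +kernel)
    (by rw [he₁, he₂]; decide +kernel) (by decide +kernel)
  have hS7 : Saturated e₁ e₂ 7 :=
    saturated_of_check hr g hg hker (by norm_num) (q₁ := 29) (q₂ := 113)
    (by norm_num) (by norm_num) (w₁ := 12) (t₁ := 17) (w₂ := 74) (t₂ := 29)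
    (a₁ := 7) (b₁ := 7) (a₂ := 28) (b₂ := 16) (by rw [he₁, he₂]; decide +kernel)
    (by rw [he₁, he₂]; decide +kernel) (by decide +kernel)
  obtain ⟨s, hs, h⟩ := eq_of_checks (p := 7) (k := 4) (by norm_num) (by norm_num)
    (by decide +kernel)
    (n₁ := 50) (n₂ := 1) (s₁ := (-1)) (s₂ := 1)
    (A := ⟨2, 3, 4, 6⟩) (B := ⟨5, 6, 6, 1⟩)
    (.inr rfl) (.inl rfl) (by rw [he₁]; decide +kernel) (by rw [he₂]; decide +kernel)
    (by norm_num) (by norm_num) (((hS2.pow 5).mul hS3).mul (hS5.pow 2)) (by norm_num)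
      (L := [(1, 0), (-1, 1)]) (.inr hS7)
    (by rw [he₁, he₂]; decide +kernel) (by decide +kernel) u v t huv ht
  simp only [List.mem_cons, List.not_mem_nil, or_false] at hs
  rcases hs with rfl | rfl
  · tauto
  · tauto

theorem solutions_neg_one_five (u v t : ℤ) (huv : form (-1) 5 u v = 1)
    (ht : t ^ 2 = 4 * sextic (-1) 5 u v + 5 ∨ t ^ 2 = -4 * sextic (-1) 5 u v + 5) :
    (u = 1 ∧ v = 0) ∨ (-u = 1 ∧ -v = 0) ∨ (u = (-2) ∧ v = 1) ∨ (-u = (-2) ∧ -v = 1) := by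
  obtain ⟨r, hr, g, hg, hker⟩ := exists_coord_of_point (x := -1) (y := 5) (k := 25)
    (by norm_num) (by norm_num) (q := 11) (by norm_num) (by decide +kernel) (by decide +kernel)
  obtain ⟨e₁, he₁⟩ := exists_unit (⟨0, 1, 0, 0⟩ : Quart ℤ (-1) 5)
    ⟨-20, -3, 0, -2⟩ (by ext <;> rfl)
  obtain ⟨e₂, he₂⟩ := exists_unit (⟨2, 1, 0, 0⟩ : Quart ℤ (-1) 5)
    ⟨-6, -7, 4, -2⟩ (by ext <;> rfl)
  have hS2 : Saturated e₁ e₂ 2 :=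
    saturated_of_check hr g hg hker (by norm_num) (q₁ := 13) (q₂ := 13)
    (by norm_num) (by norm_num) (w₁ := 8) (t₁ := 1) (w₂ := 9) (t₂ := 3)
    (a₁ := 12) (b₁ := 1) (a₂ := 1) (b₂ := 12) (by rw [he₁, he₂]; decide +kernel)
    (by rw [he₁, he₂]; decide +kernel) (by decide +kernel)
  have hS5 : Saturated e₁ e₂ 5 :=
    saturated_of_check hr g hg hker (by norm_num) (q₁ := 41) (q₂ := 61)
    (by norm_num) (by norm_num) (w₁ := 29) (t₁ := 12) (w₂ := 32) (t₂ := 56)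
    (a₁ := 18) (b₁ := 16) (a₂ := 1) (b₂ := 58) (by rw [he₁, he₂]; decide +kernel)
    (by rw [he₁, he₂]; decide +kernel) (by decide +kernel)
  have hS7 : Saturated e₁ e₂ 7 :=
    saturated_of_check hr g hg hker (by norm_num) (q₁ := 29) (q₂ := 71)
    (by norm_num) (by norm_num) (w₁ := 21) (t₁ := 19) (w₂ := 6) (t₂ := 55)
    (a₁ := 7) (b₁ := 20) (a₂ := 20) (b₂ := 20) (by rw [he₁, he₂]; decide +kernel)
    (by rw [he₁, he₂]; decide +kernel) (by decide +kernel)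
  have hS71 : Saturated e₁ e₂ 71 :=
    saturated_of_check hr g hg hker (by norm_num) (q₁ := 853) (q₂ := 1847)
    (by norm_num) (by norm_num) (w₁ := 321) (t₁ := 342) (w₂ := 827) (t₂ := 271)
    (a₁ := 538) (b₁ := 534) (a₂ := 999) (b₂ := 1813) (by rw [he₁, he₂]; decide +kernel)
    (by rw [he₁, he₂]; decide +kernel) (by decide +kernel)
  obtain ⟨s, hs, h⟩ := eq_of_checks (p := 71) (k := 1) (by norm_num) (by norm_num)
    (by decide +kernel)
    (n₁ := 35) (n₂ := 70) (s₁ := 1) (s₂ := 1)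
    (A := ⟨1, 50, 63, 38⟩) (B := ⟨53, 12, 35, 26⟩)
    (.inl rfl) (.inl rfl) (by rw [he₁]; decide +kernel) (by rw [he₂]; decide +kernel)
    (by norm_num) (by norm_num) ((hS2.mul hS5).mul hS7) (by norm_num)
      (L := [(1, 0), (-2, 1)]) (.inr hS71)
    (by rw [he₁, he₂]; decide +kernel) (by decide +kernel) u v t huv ht
  simp only [List.mem_cons, List.not_mem_nil, or_false] at hs
  rcases hs with rfl | rfl
  · tauto
  · tauto

theorem solutions_zero_five (u v t : ℤ) (huv : form 0 5 u v = 1)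
    (ht : t ^ 2 = 4 * sextic 0 5 u v + 5 ∨ t ^ 2 = -4 * sextic 0 5 u v + 5) :
    (u = 1 ∧ v = 0) ∨ (-u = 1 ∧ -v = 0) ∨ (u = (-1) ∧ v = 5) ∨ (-u = (-1) ∧ -v = 5) := by
  obtain ⟨r, hr, g, hg, hker⟩ := exists_coord_of_point (x := 0) (y := 5) (k := 25)
    (by norm_num) (by norm_num) (q := 7) (by norm_num) (by decide +kernel) (by decide +kernel)
  obtain ⟨e₁, he₁⟩ := exists_unit (⟨0, 0, 1, 0⟩ : Quart ℤ 0 5)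
    ⟨50, 0, -1, 5⟩ (by ext <;> rfl)
  obtain ⟨e₂, he₂⟩ := exists_unit (⟨8, 0, 3, 2⟩ : Quart ℤ 0 5)
    ⟨-102, -472, 357, -135⟩ (by ext <;> rfl)
  have hS2 : Saturated e₁ e₂ 2 := saturated_of_check hr g hg hker (by norm_num) (q₁ := 5) (q₂ := 5)
    (by norm_num) (by norm_num) (w₁ := 1) (t₁ := 3) (w₂ := 3) (t₂ := 2)
    (a₁ := 4) (b₁ := 4) (a₂ := 4) (b₂ := 1) (by rw [he₁, he₂]; decide +kernel)
    (by rw [he₁, he₂]; decide +kernel) (by decide +kernel)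
  have hS5 : Saturated e₁ e₂ 5 :=
    saturated_of_check hr g hg hker (by norm_num) (q₁ := 41) (q₂ := 61)
    (by norm_num) (by norm_num) (w₁ := 29) (t₁ := 31) (w₂ := 26) (t₂ := 33)
    (a₁ := 16) (b₁ := 10) (a₂ := 9) (b₂ := 34) (by rw [he₁, he₂]; decide +kernel)
    (by rw [he₁, he₂]; decide +kernel) (by decide +kernel)
  have hS7 : Saturated e₁ e₂ 7 :=
    saturated_of_check hr g hg hker (by norm_num) (q₁ := 29) (q₂ := 43)
    (by norm_num) (by norm_num) (w₁ := 3) (t₁ := 19) (w₂ := 14) (t₂ := 12)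
    (a₁ := 24) (b₁ := 16) (a₂ := 21) (b₂ := 1) (by rw [he₁, he₂]; decide +kernel)
    (by rw [he₁, he₂]; decide +kernel) (by decide +kernel)
  have hS71 : Saturated e₁ e₂ 71 :=
    saturated_of_check hr g hg hker (by norm_num) (q₁ := 853) (q₂ := 1279)
    (by norm_num) (by norm_num) (w₁ := 343) (t₁ := 394) (w₂ := 218) (t₂ := 740)
    (a₁ := 284) (b₁ := 1) (a₂ := 85) (b₂ := 1228) (by rw [he₁, he₂]; decide +kernel)
    (by rw [he₁, he₂]; decide +kernel) (by decide +kernel)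
  obtain ⟨s, hs, h⟩ := eq_of_checks (p := 71) (k := 1) (by norm_num) (by norm_num)
    (by decide +kernel)
    (n₁ := 35) (n₂ := 70) (s₁ := 1) (s₂ := 1)
    (A := ⟨19, 7, 59, 12⟩) (B := ⟨7, 25, 4, 53⟩)
    (.inl rfl) (.inl rfl) (by rw [he₁]; decide +kernel) (by rw [he₂]; decide +kernel)
    (by norm_num) (by norm_num) ((hS2.mul hS5).mul hS7) (by norm_num)
      (L := [(1, 0), (-1, 5)]) (.inr hS71)
    (by rw [he₁, he₂]; decide +kernel) (by decide +kernel) u v t huv ht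
  simp only [List.mem_cons, List.not_mem_nil, or_false] at hs
  rcases hs with rfl | rfl
  · tauto
  · tauto

theorem solutions_one_five (u v t : ℤ) (huv : form 1 5 u v = 1)
    (ht : t ^ 2 = 4 * sextic 1 5 u v + 5 ∨ t ^ 2 = -4 * sextic 1 5 u v + 5) :
    (u = 1 ∧ v = 0) ∨ (-u = 1 ∧ -v = 0) ∨ (u = 0 ∧ v = 1) ∨ (-u = 0 ∧ -v = 1) := by
  obtain ⟨r, hr, g, hg, hker⟩ := exists_coord_of_point (x := 1) (y := 5) (k := 25)
    (by norm_num) (by norm_num) (q := 7) (by norm_num) (by decide +kernel) (by decide +kernel)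
  obtain ⟨e₁, he₁⟩ := exists_unit (⟨0, 1, 0, 0⟩ : Quart ℤ 1 5)
    ⟨-20, 3, 0, -2⟩ (by ext <;> rfl)
  obtain ⟨e₂, he₂⟩ := exists_unit (⟨12, 21, 0, -4⟩ : Quart ℤ 1 5)
    ⟨7264, -6361, 4984, -1454⟩ (by ext <;> rfl)
  have hS2 : Saturated e₁ e₂ 2 :=
    saturated_of_check hr g hg hker (by norm_num) (q₁ := 29) (q₂ := 61)
    (by norm_num) (by norm_num) (w₁ := 17) (t₁ := 27) (w₂ := 38) (t₂ := 19)
    (a₁ := 28) (b₁ := 28) (a₂ := 60) (b₂ := 1) (by rw [he₁, he₂]; decide +kernel)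
    (by rw [he₁, he₂]; decide +kernel) (by decide +kernel)
  have hS5 : Saturated e₁ e₂ 5 :=
    saturated_of_check hr g hg hker (by norm_num) (q₁ := 11) (q₂ := 11)
    (by norm_num) (by norm_num) (w₁ := 2) (t₁ := 6) (w₂ := 3) (t₂ := 3)
    (a₁ := 4) (b₁ := 3) (a₂ := 9) (b₂ := 3) (by rw [he₁, he₂]; decide +kernel)
    (by rw [he₁, he₂]; decide +kernel) (by decide +kernel)
  have hS7 : Saturated e₁ e₂ 7 :=
    saturated_of_check hr g hg hker (by norm_num) (q₁ := 71) (q₂ := 71)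
    (by norm_num) (by norm_num) (w₁ := 24) (t₁ := 38) (w₂ := 25) (t₂ := 27)
    (a₁ := 37) (b₁ := 20) (a₂ := 1) (b₂ := 45) (by rw [he₁, he₂]; decide +kernel)
    (by rw [he₁, he₂]; decide +kernel) (by decide +kernel)
  have hS71 : Saturated e₁ e₂ 71 :=
    saturated_of_check hr g hg hker (by norm_num) (q₁ := 569) (q₂ := 569)
    (by norm_num) (by norm_num) (w₁ := 51) (t₁ := 161) (w₂ := 447) (t₂ := 328)
    (a₁ := 437) (b₁ := 153) (a₂ := 317) (b₂ := 33) (by rw [he₁, he₂]; decide +kernel)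
    (by rw [he₁, he₂]; decide +kernel) (by decide +kernel)
  obtain ⟨s, hs, h⟩ := eq_of_checks (p := 71) (k := 1) (by norm_num) (by norm_num)
    (by decide +kernel)
    (n₁ := 35) (n₂ := 70) (s₁ := 1) (s₂ := 1)
    (A := ⟨11, 57, 63, 63⟩) (B := ⟨51, 52, 2, 21⟩)
    (.inl rfl) (.inl rfl) (by rw [he₁]; decide +kernel) (by rw [he₂]; decide +kernel)
    (by norm_num) (by norm_num) ((hS2.mul hS5).mul hS7) (by norm_num)
      (L := [(1, 0), (0, 1)]) (.inr hS71)
    (by rw [he₁, he₂]; decide +kernel) (by decide +kernel) u v t huv ht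
  simp only [List.mem_cons, List.not_mem_nil, or_false] at hs
  rcases hs with rfl | rfl
  · tauto
  · tauto

theorem solutions_two_seven (u v t : ℤ) (huv : form 2 7 u v = 1)
    (ht : t ^ 2 = 4 * sextic 2 7 u v + 5 ∨ t ^ 2 = -4 * sextic 2 7 u v + 5) :
    False := by
  obtain ⟨r, hr, g, hg, hker⟩ := exists_coord_of_point (x := 2) (y := 7) (k := 25)
    (by norm_num) (by norm_num) (q := 11) (by norm_num) (by decide +kernel) (by decide +kernel)
  obtain ⟨e₁, he₁⟩ := exists_unit (⟨-1, 3, 0, 0⟩ : Quart ℤ 2 7)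
    ⟨-703, 159, -18, -54⟩ (by ext <;> rfl)
  obtain ⟨e₂, he₂⟩ := exists_unit (⟨81, -17, 2, 6⟩ : Quart ℤ 2 7)
    ⟨167, -77, 52, -12⟩ (by ext <;> rfl)
  have hS2 : Saturated e₁ e₂ 2 :=
    saturated_of_check hr g hg hker (by norm_num) (q₁ := 17) (q₂ := 61)
    (by norm_num) (by norm_num) (w₁ := 14) (t₁ := 10) (w₂ := 27) (t₂ := 26)
    (a₁ := 16) (b₁ := 16) (a₂ := 1) (b₂ := 60) (by rw [he₁, he₂]; decide +kernel)
    (by rw [he₁, he₂]; decide +kernel) (by decide +kernel)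
  have hS3 : Saturated e₁ e₂ 3 := saturated_of_check hr g hg hker (by norm_num) (q₁ := 7) (q₂ := 7)
    (by norm_num) (by norm_num) (w₁ := 3) (t₁ := 5) (w₂ := 4) (t₂ := 5)
    (a₁ := 1) (b₁ := 2) (a₂ := 2) (b₂ := 2) (by rw [he₁, he₂]; decide +kernel)
    (by rw [he₁, he₂]; decide +kernel) (by decide +kernel)
  obtain ⟨s, hs, h⟩ := eq_of_checks (p := 5) (k := 2) (by norm_num) (by norm_num)
    (by decide +kernel)
    (n₁ := 12) (n₂ := 6) (s₁ := (-1)) (s₂ := 1)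
    (A := ⟨2, 2, 3, 4⟩) (B := ⟨0, 3, 3, 0⟩)
    (.inr rfl) (.inl rfl) (by rw [he₁]; decide +kernel) (by rw [he₂]; decide +kernel)
    (by norm_num) (by norm_num) ((hS2.pow 3).mul hS3) (by norm_num) (L := []) (.inl rfl)
    (by rw [he₁, he₂]; decide +kernel) (by decide +kernel) u v t huv ht
  simp at hs

theorem solutions_three_eleven (u v t : ℤ) (huv : form 3 11 u v = 1)
    (ht : t ^ 2 = 4 * sextic 3 11 u v + 5 ∨ t ^ 2 = -4 * sextic 3 11 u v + 5) :
    (u = 1 ∧ v = 0) ∨ (-u = 1 ∧ -v = 0) := by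
  obtain ⟨r, hr, g, hg, hker⟩ := exists_coord_of_point (x := 3) (y := 11) (k := 25)
    (by norm_num) (by norm_num) (q := 13) (by norm_num) (by decide +kernel) (by decide +kernel)
  obtain ⟨e₁, he₁⟩ := exists_unit (⟨5, -1, 1, 0⟩ : Quart ℤ 3 11)
    ⟨57, -13, 2, 3⟩ (by ext <;> rfl)
  obtain ⟨e₂, he₂⟩ := exists_unit (⟨-69, 15, -10, -5⟩ : Quart ℤ 3 11)
    ⟨-379, 85, -15, -20⟩ (by ext <;> rfl)
  have hS2 : Saturated e₁ e₂ 2 :=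
    saturated_of_check hr g hg hker (by norm_num) (q₁ := 17) (q₂ := 29)
    (by norm_num) (by norm_num) (w₁ := 12) (t₁ := 8) (w₂ := 15) (t₂ := 21)
    (a₁ := 1) (b₁ := 16) (a₂ := 28) (b₂ := 1) (by rw [he₁, he₂]; decide +kernel)
    (by rw [he₁, he₂]; decide +kernel) (by decide +kernel)
  have hS3 : Saturated e₁ e₂ 3 := saturated_of_check hr g hg hker (by norm_num) (q₁ := 7) (q₂ := 7)
    (by norm_num) (by norm_num) (w₁ := 3) (t₁ := 0) (w₂ := 6) (t₂ := 3)
    (a₁ := 4) (b₁ := 2) (a₂ := 4) (b₂ := 1) (by rw [he₁, he₂]; decide +kernel)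
    (by rw [he₁, he₂]; decide +kernel) (by decide +kernel)
  have hS5 : Saturated e₁ e₂ 5 :=
    saturated_of_check hr g hg hker (by norm_num) (q₁ := 11) (q₂ := 11)
    (by norm_num) (by norm_num) (w₁ := 4) (t₁ := 9) (w₂ := 7) (t₂ := 9)
    (a₁ := 1) (b₁ := 5) (a₂ := 5) (b₂ := 3) (by rw [he₁, he₂]; decide +kernel)
    (by rw [he₁, he₂]; decide +kernel) (by decide +kernel)
  obtain ⟨s, hs, h⟩ := eq_of_checks (p := 5) (k := 2) (by norm_num) (by norm_num)
    (by decide +kernel)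
    (n₁ := 6) (n₂ := 1) (s₁ := (-1)) (s₂ := 1)
    (A := ⟨0, 3, 4, 0⟩) (B := ⟨1, 3, 3, 4⟩)
    (.inr rfl) (.inl rfl) (by rw [he₁]; decide +kernel) (by rw [he₂]; decide +kernel)
    (by norm_num) (by norm_num) ((hS2.pow 3).mul hS3) (by norm_num) (L := [(1, 0)]) (.inr hS5)
    (by rw [he₁, he₂]; decide +kernel) (by decide +kernel) u v t huv ht
  simp only [List.mem_cons, List.not_mem_nil, or_false] at hs
  subst hs
  exact h

theorem solutions_seven_thirtySeven (u v t : ℤ) (huv : form 7 37 u v = 1)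
    (ht : t ^ 2 = 4 * sextic 7 37 u v + 5 ∨ t ^ 2 = -4 * sextic 7 37 u v + 5) :
    False := by
  obtain ⟨r, hr, g, hg, hker⟩ := exists_coord_of_point (x := 7) (y := 37) (k := 25)
    (by norm_num) (by norm_num) (q := 7) (by norm_num) (by decide +kernel) (by decide +kernel)
  obtain ⟨e₁, he₁⟩ := exists_unit (⟨-2, 1, 0, 0⟩ : Quart ℤ 7 37)
    ⟨-114, 17, -4, -2⟩ (by ext <;> rfl)
  obtain ⟨e₂, he₂⟩ := exists_unit (⟨-2463, 369, -84, -43⟩ : Quart ℤ 7 37)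
    ⟨-919, 209, -79, 10⟩ (by ext <;> rfl)
  have hS2 : Saturated e₁ e₂ 2 :=
    saturated_of_check hr g hg hker (by norm_num) (q₁ := 13) (q₂ := 17)
    (by norm_num) (by norm_num) (w₁ := 0) (t₁ := 9) (w₂ := 14) (t₂ := 11)
    (a₁ := 12) (b₁ := 12) (a₂ := 16) (b₂ := 1) (by rw [he₁, he₂]; decide +kernel)
    (by rw [he₁, he₂]; decide +kernel) (by decide +kernel)
  have hS3 : Saturated e₁ e₂ 3 :=
    saturated_of_check hr g hg hker (by norm_num) (q₁ := 13) (q₂ := 19)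
    (by norm_num) (by norm_num) (w₁ := 0) (t₁ := 9) (w₂ := 12) (t₂ := 14)
    (a₁ := 3) (b₁ := 1) (a₂ := 11) (b₂ := 11) (by rw [he₁, he₂]; decide +kernel)
    (by rw [he₁, he₂]; decide +kernel) (by decide +kernel)
  obtain ⟨s, hs, h⟩ := eq_of_checks (p := 5) (k := 2) (by norm_num) (by norm_num)
    (by decide +kernel)
    (n₁ := 12) (n₂ := 3) (s₁ := (-1)) (s₂ := (-1))
    (A := ⟨0, 3, 0, 0⟩) (B := ⟨1, 4, 3, 2⟩)
    (.inr rfl) (.inr rfl) (by rw [he₁]; decide +kernel) (by rw [he₂]; decide +kernel)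
    (by norm_num) (by norm_num) ((hS2.pow 3).mul hS3) (by norm_num) (L := []) (.inl rfl)
    (by rw [he₁, he₂]; decide +kernel) (by decide +kernel) u v t huv ht
  simp at hs

theorem solutions_two_one (u v t : ℤ) (huv : form 2 1 u v = 1)
    (ht : t ^ 2 = 4 * sextic 2 1 u v + 5 ∨ t ^ 2 = -4 * sextic 2 1 u v + 5) :
    (u = 1 ∧ v = 0) ∨ (-u = 1 ∧ -v = 0) := by
  obtain ⟨r, hr, g, hg, hker⟩ := exists_coord_of_point (x := 2) (y := 1) (k := -23)
    (by norm_num) (by norm_num) (q := 7) (by norm_num) (by decide +kernel) (by decide +kernel)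
  obtain ⟨e₁, he₁⟩ := exists_unit (⟨-4, 2, -1, 0⟩ : Quart ℤ 2 1)
    ⟨10, 2, 3, 1⟩ (by ext <;> rfl)
  obtain ⟨e₂, he₂⟩ :=
    exists_unit (⟨15759901854705052432024095590488720058980956,
    3826439337798968420046358972199238427751605, 4708181504913036190875573051786594094348325,
    1387403977033315025331981919423467847226220⟩ : Quart ℤ 2 1)
    ⟨6941964968857734382031296078852299146, -2186281526523360272002197609892551605,
      2108309374386256892777004088880824225, -570286017303784920123802364085105945⟩ (by ext <;> rfl)
  have hS2 : Saturated e₁ e₂ 2 := saturated_of_check hr g hg hker (by norm_num) (q₁ := 5) (q₂ := 29)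
    (by norm_num) (by norm_num) (w₁ := 1) (t₁ := 0) (w₂ := 18) (t₂ := 14)
    (a₁ := 4) (b₁ := 1) (a₂ := 28) (b₂ := 28) (by rw [he₁, he₂]; decide +kernel)
    (by rw [he₁, he₂]; decide +kernel) (by decide +kernel)
  have hS5 : Saturated e₁ e₂ 5 :=
    saturated_of_check hr g hg hker (by norm_num) (q₁ := 11) (q₂ := 41)
    (by norm_num) (by norm_num) (w₁ := 6) (t₁ := 4) (w₂ := 9) (t₂ := 17)
    (a₁ := 5) (b₁ := 9) (a₂ := 1) (b₂ := 16) (by rw [he₁, he₂]; decide +kernel)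
    (by rw [he₁, he₂]; decide +kernel) (by decide +kernel)
  have hS31 : Saturated e₁ e₂ 31 :=
    saturated_of_check hr g hg hker (by norm_num) (q₁ := 1117) (q₂ := 1303)
    (by norm_num) (by norm_num) (w₁ := 939) (t₁ := 201) (w₂ := 167) (t₂ := 260)
    (a₁ := 102) (b₁ := 520) (a₂ := 511) (b₂ := 1028) (by rw [he₁, he₂]; decide +kernel)
    (by rw [he₁, he₂]; decide +kernel) (by decide +kernel)
  obtain ⟨s, hs, h⟩ := eq_of_checks (p := 5) (k := 3) (by norm_num) (by norm_num)
    (by decide +kernel)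
    (n₁ := 62) (n₂ := 1) (s₁ := (-1)) (s₂ := 1)
    (A := ⟨1, 3, 1, 4⟩) (B := ⟨1, 1, 0, 4⟩)
    (.inr rfl) (.inl rfl) (by rw [he₁]; decide +kernel) (by rw [he₂]; decide +kernel)
    (by norm_num) (by norm_num) ((hS2.pow 2).mul hS31) (by norm_num) (L := [(1, 0)]) (.inr hS5)
    (by rw [he₁, he₂]; decide +kernel) (by decide +kernel) u v t huv ht
  simp only [List.mem_cons, List.not_mem_nil, or_false] at hs
  subst hs
  exact h

end Quart

namespace Quart

open scoped MatrixGroups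

/-- Every positive definite real binary quadratic form takes a small value at a coprime pair. -/
lemma exists_isCoprime_three_mul_sq_le (σ : ℝ) {Q : ℝ} (hQ : 0 < Q) :
    ∃ u v : ℤ, IsCoprime u v ∧ 3 * ((u + σ * v) ^ 2 + Q * v ^ 2) ^ 2 ≤ 4 * Q := by
  obtain ⟨g, hg⟩ := ModularGroup.exists_smul_mem_fd ⟨⟨σ, √Q⟩, Real.sqrt_pos.2 hQ⟩
  refine ⟨g 1 1, g 1 0, (ModularGroup.bottom_row_coprime g).symm, ?_⟩
  have h := ModularGroup.three_le_four_mul_im_sq_of_mem_fd hg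
  rw [ModularGroup.im_smul_eq_div_normSq, ModularGroup.denom_apply, div_pow] at h
  have hn : Complex.normSq (g 1 0 * (⟨σ, √Q⟩ : ℂ) + g 1 1) =
      (g 1 1 + σ * g 1 0) ^ 2 + Q * (g 1 0 : ℝ) ^ 2 := by
    have : √Q ^ 2 = Q := Real.sq_sqrt hQ.le
    simp [Complex.normSq_apply]
    linear_combination (g 1 0 : ℝ) ^ 2 * this
  change 3 ≤ 4 * (√Q ^ 2 / Complex.normSq (g 1 0 * (⟨σ, √Q⟩ : ℂ) + g 1 1) ^ 2) at h
  rw [hn, Real.sq_sqrt hQ.le] at h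
  have hA : 0 < (((g 1 1 + σ * g 1 0) ^ 2 + Q * (g 1 0 : ℝ) ^ 2)) ^ 2 := by
    by_contra! h0
    have := le_antisymm h0 (sq_nonneg _)
    rw [this] at h
    norm_num at h
  rw [← mul_div_assoc, le_div_iff₀ hA] at h
  exact h

/-- The Hessian covariant of `form x y`. -/
def hess (x y u v : ℤ) : ℤ :=
  x * u ^ 4 - 2 * y * u ^ 3 * v + (6 * x ^ 2 - 4) * u ^ 2 * v ^ 2 - 2 * x * y * u * v ^ 3
    + (y ^ 2 + x * (4 - 3 * x ^ 2)) * v ^ 4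

lemma hess_neg (x y u v : ℤ) : hess x y (-u) (-v) = hess x y u v := by simp only [hess]; ring

lemma exists_reduced {x y k : ℤ} (hk : k = 25 ∨ k = -23) (hxy : y ^ 2 = 4 * x ^ 3 - 4 * x + k)
    {e : ℝ} (he : 4 * e ^ 3 - 4 * e + k = 0) (hex : e < x) (he2 : 4 < 3 * e ^ 2) :
    ∃ u v : ℤ, IsCoprime u v ∧ 0 ≤ hess x y u v - e * form x y u v ∧
      4 * (hess x y u v - e * form x y u v) ≤
        4 / 3 * (3 * e ^ 2 - 4) - 6 * e * form x y u v - 3 / 4 * (form x y u v : ℝ) ^ 2 := by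
  have hy : (y : ℝ) ≠ 0 := by
    have := odd_of_point hk hxy
    rintro h
    rw [Int.cast_eq_zero.1 h] at this
    simp at this
  obtain ⟨σ, P, Q, hP, hQ, hσ, h1, h2, h3, h4⟩ :=
    exists_factorization he (by exact_mod_cast hxy) hex hy he2
  obtain ⟨u, v, huv, hA⟩ := exists_isCoprime_three_mul_sq_le σ hQ
  refine ⟨u, v, huv, ?_⟩
  have hF : (form x y u v : ℝ) = ((u + σ * v) ^ 2 + Q * v ^ 2) * ((u - σ * v) ^ 2 - P * v ^ 2) := by
    simp only [form]; push_cast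
    linear_combination -(u : ℝ) ^ 2 * v ^ 2 * h1 + 2 * u * v ^ 3 * h2 - v ^ 4 * h3
  obtain rfl : e = x - σ ^ 2 := by linarith
  obtain rfl : Q = P + 2 * σ ^ 2 - 6 * x := by linarith
  set W := -2 * σ * (u : ℝ) ^ 2 - (P + (P + 2 * σ ^ 2 - 6 * x)) * u * v
    + (2 * σ ^ 3 + σ * ((P + 2 * σ ^ 2 - 6 * x) - P)) * v ^ 2
  set q₁ := ((u + σ * v) ^ 2 + (P + 2 * σ ^ 2 - 6 * x) * (v : ℝ) ^ 2)
  set q₂ := ((u - σ * v) ^ 2 - P * (v : ℝ) ^ 2)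
  have hW : 4 * (hess x y u v - (x - σ ^ 2) * form x y u v) = W ^ 2 := by
    have hy' : (y : ℝ) = -σ * (P + (P + 2 * σ ^ 2 - 6 * x)) / 2 := by linarith
    have h4' : (4 : ℝ) = 3 * (x - σ ^ 2) ^ 2 - P * (P + 2 * σ ^ 2 - 6 * x) := by linarith
    rw [hF]
    simp only [hess]; push_cast
    linear_combination (-8 * u ^ 3 * v - 8 * x * u * v ^ 3
      + 4 * v ^ 4 * (y - σ * (P + (P + 2 * σ ^ 2 - 6 * x)) / 2)) * hy'
      + 4 * (x * v ^ 4 - u ^ 2 * v ^ 2) * h4'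
  have hW2 : W ^ 2 = P * q₁ ^ 2 - 6 * (x - σ ^ 2) * (q₁ * q₂)
      - (P + 2 * σ ^ 2 - 6 * x) * q₂ ^ 2 := by
    simp only [W, q₁, q₂]; ring
  refine ⟨by linarith [sq_nonneg W], ?_⟩
  rw [hW, hW2, hF]
  have h5 : P * (3 * q₁ ^ 2) ≤ P * (4 * (P + 2 * σ ^ 2 - 6 * x)) :=
    mul_le_mul_of_nonneg_left hA hP.le
  have h6 : 3 * q₁ ^ 2 * q₂ ^ 2 ≤ 4 * (P + 2 * σ ^ 2 - 6 * x) * q₂ ^ 2 :=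
    mul_le_mul_of_nonneg_right hA (sq_nonneg _)
  linarith

end Quart

/-- The binary quartic form `a U ^ 4 + 4 b U ^ 3 V + 6 c U ^ 2 V ^ 2 + 4 d U V ^ 3 + e V ^ 4`. -/
@[ext] structure BinaryQuartic where
  (a b c d e : ℤ)

namespace BinaryQuartic

/-- The values of a binary quartic form. -/
def eval (f : BinaryQuartic) (u v : ℤ) : ℤ :=
  f.a * u ^ 4 + 4 * f.b * u ^ 3 * v + 6 * f.c * u ^ 2 * v ^ 2 + 4 * f.d * u * v ^ 3 + f.e * v ^ 4

/-- The substitution `(U, V) ↦ (p U + q V, r U + s V)`. -/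
def act (f : BinaryQuartic) (p q r s : ℤ) : BinaryQuartic where
  a := f.eval p r
  b := f.a * p ^ 3 * q + f.b * (p ^ 3 * s + 3 * p ^ 2 * q * r)
    + 3 * f.c * (p ^ 2 * r * s + p * q * r ^ 2) + f.d * (3 * p * r ^ 2 * s + q * r ^ 3)
    + f.e * r ^ 3 * s
  c := f.a * p ^ 2 * q ^ 2 + 2 * f.b * (p ^ 2 * q * s + p * q ^ 2 * r)
    + f.c * (p ^ 2 * s ^ 2 + 4 * p * q * r * s + q ^ 2 * r ^ 2)
    + 2 * f.d * (p * r * s ^ 2 + q * r ^ 2 * s) + f.e * r ^ 2 * s ^ 2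
  d := f.a * q ^ 3 * p + f.b * (q ^ 3 * r + 3 * q ^ 2 * p * s)
    + 3 * f.c * (q ^ 2 * s * r + q * p * s ^ 2) + f.d * (3 * q * s ^ 2 * r + p * s ^ 3)
    + f.e * s ^ 3 * r
  e := f.eval q s

/-- The quadratic invariant. -/
def invI (f : BinaryQuartic) : ℤ := f.a * f.e - 4 * f.b * f.d + 3 * f.c ^ 2

/-- The cubic invariant. -/
def invJ (f : BinaryQuartic) : ℤ :=
  f.a * f.c * f.e + 2 * f.b * f.c * f.d - f.a * f.d ^ 2 - f.b ^ 2 * f.e - f.c ^ 3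

lemma act_act (f : BinaryQuartic) (p q r s p' q' r' s' : ℤ) :
    (f.act p q r s).act p' q' r' s' =
      f.act (p * p' + q * r') (p * q' + q * s') (r * p' + s * r') (r * q' + s * s') := by
  ext <;> simp only [act, eval] <;> ring

lemma invI_act (f : BinaryQuartic) (p q r s : ℤ) :
    (f.act p q r s).invI = (p * s - q * r) ^ 4 * f.invI := by
  simp only [act, eval, invI]; ring

lemma invJ_act (f : BinaryQuartic) (p q r s : ℤ) :
    (f.act p q r s).invJ = (p * s - q * r) ^ 6 * f.invJ := by
  simp only [act, eval, invJ]; ring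

/-- Equivalence of binary quartic forms under integral unimodular substitutions. -/
def Equivalent (f g : BinaryQuartic) : Prop :=
  ∃ p q r s : ℤ, (p * s - q * r) ^ 2 = 1 ∧ g = f.act p q r s

lemma Equivalent.trans {f g h : BinaryQuartic} (h₁ : f.Equivalent g) (h₂ : g.Equivalent h) :
    f.Equivalent h := by
  obtain ⟨p, q, r, s, hd, rfl⟩ := h₁
  obtain ⟨p', q', r', s', hd', rfl⟩ := h₂
  refine ⟨_, _, _, _, ?_, act_act ..⟩
  linear_combination (p * s - q * r) ^ 2 * hd' + hd

lemma Equivalent.symm {f g : BinaryQuartic} (h : f.Equivalent g) : g.Equivalent f := by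
  obtain ⟨p, q, r, s, hd, rfl⟩ := h
  have hd4 : (p * s - q * r) ^ 4 = 1 := by linear_combination ((p * s - q * r) ^ 2 + 1) * hd
  refine ⟨s, -q, -r, p, by linear_combination hd, ?_⟩
  rw [act_act]
  ext <;> simp only [act, eval]
  · linear_combination -f.a * hd4
  · linear_combination -f.b * hd4
  · linear_combination -f.c * hd4
  · linear_combination -f.d * hd4
  · linear_combination -f.e * hd4

lemma Equivalent.invI_eq {f g : BinaryQuartic} (h : f.Equivalent g) : g.invI = f.invI := by
  obtain ⟨p, q, r, s, hd, rfl⟩ := h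
  rw [invI_act]
  linear_combination ((p * s - q * r) ^ 2 + 1) * f.invI * hd

lemma Equivalent.invJ_eq {f g : BinaryQuartic} (h : f.Equivalent g) : g.invJ = f.invJ := by
  obtain ⟨p, q, r, s, hd, rfl⟩ := h
  rw [invJ_act]
  linear_combination ((p * s - q * r) ^ 4 + (p * s - q * r) ^ 2 + 1) * f.invJ * hd

/-- The form attached to the point `(x, y)`. -/
def ofPoint (x y : ℤ) : BinaryQuartic := ⟨1, 0, -x, y, 4 - 3 * x ^ 2⟩

lemma eval_ofPoint (x y u v : ℤ) : (ofPoint x y).eval u v = Quart.form x y u v := by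
  simp only [eval, ofPoint, Quart.form]; ring

lemma hess_act (f : BinaryQuartic) (p q r s : ℤ) :
    (f.act p q r s).b ^ 2 - (f.act p q r s).a * (f.act p q r s).c =
      (p * s - q * r) ^ 2 * ((f.b ^ 2 - f.a * f.c) * p ^ 4 + 2 * (f.b * f.c - f.a * f.d) * p ^ 3 * r
        + (3 * f.c ^ 2 - 2 * f.b * f.d - f.a * f.e) * p ^ 2 * r ^ 2
        + 2 * (f.c * f.d - f.b * f.e) * p * r ^ 3 + (f.d ^ 2 - f.c * f.e) * r ^ 4) := by
  simp only [act, eval]; ring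

lemma hess_act_ofPoint (x y p q r s : ℤ) (hd : (p * s - q * r) ^ 2 = 1) :
    ((ofPoint x y).act p q r s).b ^ 2
      - ((ofPoint x y).act p q r s).a * ((ofPoint x y).act p q r s).c = Quart.hess x y p r := by
  rw [hess_act, hd]
  simp only [ofPoint, Quart.hess]; ring

lemma eq_ofPoint {f : BinaryQuartic} (ha : f.a = 1) (hb : f.b = 0) (hI : f.invI = 4) :
    f = ofPoint (-f.c) f.d := by
  simp only [invI, ha, hb] at hI
  ext <;> simp only [ofPoint, ha, hb]
  · ring
  · linarith

lemma invI_ofPoint (x y : ℤ) : (ofPoint x y).invI = 4 := by simp only [ofPoint, invI]; ring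

lemma invJ_ofPoint (x y : ℤ) : (ofPoint x y).invJ = 4 * x ^ 3 - 4 * x - y ^ 2 := by
  simp only [ofPoint, invJ]; ring

/-- Points whose forms are equivalent are related by the covariants. -/
lemma Equivalent.ofPoint_eq {x y x' y' : ℤ} (h : (ofPoint x' y').Equivalent (ofPoint x y)) :
    ∃ u v, Quart.form x' y' u v = 1 ∧ x = Quart.hess x' y' u v ∧
      (y = Quart.sextic x' y' u v ∨ y = -Quart.sextic x' y' u v) := by
  obtain ⟨p, q, r, s, hd, h⟩ := h
  have ha : Quart.form x' y' p r = 1 := by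
    rw [← eval_ofPoint]; exact (congrArg BinaryQuartic.a h).symm
  refine ⟨p, r, ha, ?_, ?_⟩
  · have := hess_act_ofPoint x' y' p q r s hd
    rw [← h] at this
    rw [← this]; simp [ofPoint]
  · have key : ((ofPoint x' y').act p q r s).a ^ 2 * ((ofPoint x' y').act p q r s).d
        - 3 * ((ofPoint x' y').act p q r s).a * ((ofPoint x' y').act p q r s).b *
          ((ofPoint x' y').act p q r s).c + 2 * ((ofPoint x' y').act p q r s).b ^ 3 =
        (p * s - q * r) ^ 3 * Quart.sextic x' y' p r := by
      simp only [act, eval, ofPoint, Quart.sextic]; ring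
    rw [← h] at key
    rcases sq_eq_one_iff.1 hd with h1 | h1 <;> rw [h1] at key
    · left; simpa [ofPoint] using key
    · right; simpa [ofPoint] using key

/-- The integer part of the square root of `v`, if `v < 4 ^ n`. -/
def isqrt : ℕ → ℕ → ℕ
  | 0, _ => 0
  | n + 1, v =>
    let r := 2 * isqrt n (v / 4)
    if (r + 1) * (r + 1) ≤ v then r + 1 else r

/-- Recover the last two coefficients of a form from the first three and the value of the sextic
covariant at `(1, 0)`, and check that the result is one of the expected forms. -/
def lastCheck (a b c G : ℤ) : Bool :=
  let n := G + 3 * a * b * c - 2 * (b * b * b)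
  let d := n / (a * a)
  let m := 4 - 3 * (c * c) + 4 * b * d
  let e := m / a
  a * a * d != n || a * e != m || a == 1 ||
    (e == 1 && (d * d - c == 2 || d * d - c == 3 || d * d - c == 7))

/-- Check `lastCheck` for all admissible values of the sextic covariant. -/
def firstCheck (k a b c : ℤ) : Bool :=
  let H := b * b - a * c
  let v := 4 * (H * H * H) - 4 * (a * a) * H + k * (a * a * a)
  let s : ℤ := isqrt 12 v.toNat
  v < 0 || (s * s < v && v < (s + 1) * (s + 1)) ||
    (s * s == v && lastCheck a b c s && lastCheck a b c (-s))

lemma firstCheck_pos : ∀ a ∈ Finset.Icc (1 : ℤ) 17, ∀ b ∈ Finset.Icc (-8 : ℤ) 8,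
    ∀ c ∈ Finset.Icc (-7 : ℤ) 7, 2 * b ≤ a → -a ≤ 2 * b → -203 * a ≤ 100 * (b * b - a * c) →
    400 * (b * b - a * c) ≤ 406 * a - 75 * (a * a) + 1116 → firstCheck 25 a b c = true := by
  decide +kernel

lemma firstCheck_neg : ∀ a ∈ Finset.Icc (-17 : ℤ) (-1), ∀ b ∈ Finset.Icc (-8 : ℤ) 8,
    ∀ c ∈ Finset.Icc (-7 : ℤ) 7, 2 * b ≤ -a → a ≤ 2 * b → 198 * a ≤ 100 * (b * b - a * c) →
    400 * (b * b - a * c) ≤ -396 * a - 75 * (a * a) + 1035 → firstCheck (-23) a b c = true := by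
  decide +kernel

lemma of_lastCheck {f : BinaryQuartic} (hI : f.invI = 4) (ha : f.a ≠ 0)
    (h : lastCheck f.a f.b f.c (f.a ^ 2 * f.d - 3 * f.a * f.b * f.c + 2 * f.b ^ 3) = true) :
    f.a = 1 ∨ f.e = 1 ∧ (f.d ^ 2 - f.c = 2 ∨ f.d ^ 2 - f.c = 3 ∨ f.d ^ 2 - f.c = 7) := by
  have h1 : f.a ^ 2 * f.d - 3 * f.a * f.b * f.c + 2 * f.b ^ 3 + 3 * f.a * f.b * f.c
      - 2 * (f.b * f.b * f.b) = f.a * f.a * f.d := by ring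
  have h2 : 4 - 3 * (f.c * f.c) + 4 * f.b * f.d = f.a * f.e := by
    simp only [invI] at hI; linear_combination -hI
  simp only [lastCheck, h1, Int.mul_ediv_cancel_left _ (mul_ne_zero ha ha), h2,
    Int.mul_ediv_cancel_left _ ha] at h
  simpa [sq, or_assoc] using h

lemma of_firstCheck {f : BinaryQuartic} (hI : f.invI = 4) (ha : f.a ≠ 0)
    (h : firstCheck (-f.invJ) f.a f.b f.c = true) :
    f.a = 1 ∨ f.e = 1 ∧ (f.d ^ 2 - f.c = 2 ∨ f.d ^ 2 - f.c = 3 ∨ f.d ^ 2 - f.c = 7) := by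
  have hG : 4 * ((f.b * f.b - f.a * f.c) * (f.b * f.b - f.a * f.c) * (f.b * f.b - f.a * f.c))
      - 4 * (f.a * f.a) * (f.b * f.b - f.a * f.c) + -f.invJ * (f.a * f.a * f.a) =
      (f.a ^ 2 * f.d - 3 * f.a * f.b * f.c + 2 * f.b ^ 3) ^ 2 := by
    have : 4 * ((f.b * f.b - f.a * f.c) * (f.b * f.b - f.a * f.c) * (f.b * f.b - f.a * f.c))
      - f.invI * (f.a * f.a) * (f.b * f.b - f.a * f.c) + -f.invJ * (f.a * f.a * f.a) =
      (f.a ^ 2 * f.d - 3 * f.a * f.b * f.c + 2 * f.b ^ 3) ^ 2 := by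
      simp only [invI, invJ]; ring
    rw [← this, hI]
  refine of_lastCheck hI ha ?_
  simp only [firstCheck, hG] at h
  set G := f.a ^ 2 * f.d - 3 * f.a * f.b * f.c + 2 * f.b ^ 3
  generalize (isqrt 12 (G ^ 2).toNat) = s at h
  simp only [Bool.or_eq_true, Bool.and_eq_true, decide_eq_true_eq,
    beq_iff_eq] at h
  rcases h with (h | ⟨h1, h2⟩) | ⟨⟨h1, h2⟩, h3⟩
  · exact absurd h (not_lt.2 (sq_nonneg _))
  · rw [← sq, sq_lt_sq, abs_of_nonneg (Int.natCast_nonneg s)] at h1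
    rw [← sq, sq_lt_sq, abs_of_nonneg (by positivity : (0 : ℤ) ≤ s + 1)] at h2
    omega
  · rw [← sq, sq_eq_sq_iff_eq_or_eq_neg] at h1
    rcases h1 with h1 | h1
    · rwa [← h1]
    · rwa [← neg_eq_iff_eq_neg.2 h1]

/-- A translation making the second coefficient small. -/
lemma exists_translate (f : BinaryQuartic) (ha : f.a ≠ 0) :
    ∃ n : ℤ, 2 * (f.act 1 n 0 1).b ≤ |f.a| ∧ -|f.a| ≤ 2 * (f.act 1 n 0 1).b := by
  refine ⟨-((2 * f.b + |f.a|) / (2 * |f.a|) * f.a.sign), ?_⟩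
  have h0 : 0 < 2 * |f.a| := by positivity
  have hb : (f.act 1 (-((2 * f.b + |f.a|) / (2 * |f.a|) * f.a.sign)) 0 1).b =
      f.b - (2 * f.b + |f.a|) / (2 * |f.a|) * |f.a| := by
    rw [Int.abs_eq_natAbs, ← Int.sign_mul_self_eq_natAbs]; simp only [act]; ring
  rw [hb]
  have h1 := Int.emod_add_mul_ediv (2 * f.b + |f.a|) (2 * |f.a|)
  have h2 := Int.emod_nonneg (2 * f.b + |f.a|) h0.ne'
  have h3 := Int.emod_lt_of_pos (2 * f.b + |f.a|) h0
  constructor <;> linarith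

lemma c_bounds_pos {a b c : ℤ} (h1 : 2 * b ≤ a) (h2 : -a ≤ 2 * b)
    (h3 : -203 * a ≤ 100 * (b * b - a * c))
    (h4 : 400 * (b * b - a * c) ≤ 406 * a - 75 * (a * a) + 1116) (ha : 0 < a) (ha' : a ≤ 17) :
    -7 ≤ c ∧ c ≤ 7 := by
  have hb : 4 * (b * b) ≤ a * a := by nlinarith
  have hb0 := mul_self_nonneg b
  generalize b * b = B at *
  constructor <;> interval_cases a <;> omega

lemma c_bounds_neg {a b c : ℤ} (h1 : 2 * b ≤ -a) (h2 : a ≤ 2 * b)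
    (h3 : 198 * a ≤ 100 * (b * b - a * c))
    (h4 : 400 * (b * b - a * c) ≤ -396 * a - 75 * (a * a) + 1035) (ha : a < 0) (ha' : -17 ≤ a) :
    -7 ≤ c ∧ c ≤ 7 := by
  have hb : 4 * (b * b) ≤ a * a := by nlinarith
  have hb0 := mul_self_nonneg b
  generalize b * b = B at *
  constructor <;> interval_cases a <;> omega

lemma first_bounds_pos {H a e : ℝ} (he : -2.03 < e) (he' : e < -2.02) (h1 : 0 ≤ H - e * a)
    (h2 : 4 * (H - e * a) ≤ 4 / 3 * (3 * e ^ 2 - 4) - 6 * e * a - 3 / 4 * a ^ 2) :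
    -0.9 < a ∧ a < 18 ∧ (0 ≤ a → -203 * a ≤ 100 * H ∧
      400 * H ≤ 406 * a - 75 * a ^ 2 + 1116) := by
  have hee : e ^ 2 ≤ 2.03 ^ 2 := by nlinarith
  have hpos : 0 ≤ a → e * a ≤ -2.02 * a ∧ -2.03 * a ≤ e * a := fun h =>
    ⟨mul_le_mul_of_nonneg_right he'.le h, mul_le_mul_of_nonneg_right he.le h⟩
  refine ⟨?_, ?_, fun h => ?_⟩
  · by_contra! h
    have := mul_le_mul_of_nonpos_right he'.le (by linarith : a ≤ 0)
    nlinarith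
  · by_contra! h
    have := hpos (by linarith)
    nlinarith
  · have := hpos h
    constructor <;> linarith

lemma first_bounds_neg {H a e : ℝ} (he : 1.97 < e) (he' : e < 1.98) (h1 : 0 ≤ H - e * a)
    (h2 : 4 * (H - e * a) ≤ 4 / 3 * (3 * e ^ 2 - 4) - 6 * e * a - 3 / 4 * a ^ 2) :
    -18 < a ∧ a < 0.9 ∧ (a ≤ 0 → 198 * a ≤ 100 * H ∧
      400 * H ≤ -396 * a - 75 * a ^ 2 + 1035) := by
  have hee : e ^ 2 ≤ 1.98 ^ 2 := by nlinarith
  have hneg : a ≤ 0 → e * a ≤ 1.97 * a ∧ 1.98 * a ≤ e * a := fun h =>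
    ⟨mul_le_mul_of_nonpos_right he.le h, mul_le_mul_of_nonpos_right he'.le h⟩
  refine ⟨?_, ?_, fun h => ?_⟩
  · by_contra! h
    have := hneg (by linarith)
    nlinarith
  · by_contra! h
    have := mul_le_mul_of_nonneg_right he.le (by linarith : 0 ≤ a)
    nlinarith
  · have := hneg h
    constructor <;> linarith

/-- Every form attached to a point is equivalent to a form whose first two coefficients and
leading Hessian coefficient are small. -/
lemma exists_reduced {x y k : ℤ} (hk : k = 25 ∨ k = -23) (hxy : y ^ 2 = 4 * x ^ 3 - 4 * x + k) :
    ∃ f : BinaryQuartic, (ofPoint x y).Equivalent f ∧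
      (f.a = 0 ∧ f.b ^ 2 ≤ 2 ∨
        k = 25 ∧ 0 < f.a ∧ f.a ≤ 17 ∧ -203 * f.a ≤ 100 * (f.b * f.b - f.a * f.c) ∧
          400 * (f.b * f.b - f.a * f.c) ≤ 406 * f.a - 75 * (f.a * f.a) + 1116 ∨
        k = -23 ∧ f.a < 0 ∧ -17 ≤ f.a ∧ 198 * f.a ≤ 100 * (f.b * f.b - f.a * f.c) ∧
          400 * (f.b * f.b - f.a * f.c) ≤ -396 * f.a - 75 * (f.a * f.a) + 1035) := by
  obtain ⟨e, he, hex, he2, hek⟩ := Quart.exists_real_root x y k hk hxy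
  obtain ⟨u, v, ⟨m, n, huv⟩, h1, h2⟩ := Quart.exists_reduced hk hxy he hex he2
  have hd : (u * m - (-n) * v) ^ 2 = 1 := by
    have : u * m - (-n) * v = 1 := by linear_combination huv
    rw [this, one_pow]
  refine ⟨(ofPoint x y).act u (-n) v m, ⟨_, _, _, _, hd, rfl⟩, ?_⟩
  have hH := hess_act_ofPoint x y u (-n) v m hd
  have ha : ((ofPoint x y).act u (-n) v m).a = Quart.form x y u v := eval_ofPoint ..
  rw [← hH, ← ha] at h1 h2
  generalize (ofPoint x y).act u (-n) v m = f at *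
  simp only [← sq]
  rcases hek with ⟨rfl, he3, he4⟩ | ⟨rfl, he3, he4⟩
  · obtain ⟨h3, h4, h5⟩ := first_bounds_pos he3 he4 h1 h2
    have h3' : (-1 : ℝ) < f.a := by linarith
    have h3' : -1 < f.a := by exact_mod_cast h3'
    have h4' : f.a < 18 := by exact_mod_cast h4
    have h0 : 0 ≤ f.a := by omega
    obtain ⟨h6, h7⟩ := h5 (by exact_mod_cast h0)
    have h6' : -203 * f.a ≤ 100 * (f.b ^ 2 - f.a * f.c) := by exact_mod_cast h6
    have h7' : 400 * (f.b ^ 2 - f.a * f.c) ≤ 406 * f.a - 75 * f.a ^ 2 + 1116 := by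
      exact_mod_cast h7
    rcases h0.eq_or_lt with h0 | h0
    · rw [← h0] at h7'
      exact .inl ⟨h0.symm, by linarith⟩
    · exact .inr (.inl ⟨rfl, h0, by omega, h6', h7'⟩)
  · obtain ⟨h3, h4, h5⟩ := first_bounds_neg he3 he4 h1 h2
    have h4' : (f.a : ℝ) < 1 := by linarith
    have h4' : f.a < 1 := by exact_mod_cast h4'
    have h3' : -18 < f.a := by exact_mod_cast h3
    have h0 : f.a ≤ 0 := by omega
    obtain ⟨h6, h7⟩ := h5 (by exact_mod_cast h0)
    have h6' : 198 * f.a ≤ 100 * (f.b ^ 2 - f.a * f.c) := by exact_mod_cast h6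
    have h7' : 400 * (f.b ^ 2 - f.a * f.c) ≤ -396 * f.a - 75 * f.a ^ 2 + 1035 := by
      exact_mod_cast h7
    rcases h0.eq_or_lt with h0 | h0
    · rw [h0] at h7'
      exact .inl ⟨h0, by linarith⟩
    · exact .inr (.inr ⟨rfl, h0, by omega, h6', h7'⟩)

lemma act_translate_hess (f : BinaryQuartic) (n : ℤ) :
    (f.act 1 n 0 1).b * (f.act 1 n 0 1).b - (f.act 1 n 0 1).a * (f.act 1 n 0 1).c =
      f.b * f.b - f.a * f.c := by
  simp only [act, eval]; ring

/-- An equivalent form attached to a small point, unless the form represents zero. -/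
lemma exists_equivalent_ofPoint {x y k : ℤ} (hk : k = 25 ∨ k = -23)
    (hxy : y ^ 2 = 4 * x ^ 3 - 4 * x + k) :
    (∃ x' y', -2 ≤ x' ∧ x' ≤ 7 ∧ (ofPoint x' y').Equivalent (ofPoint x y)) ∨
      ∃ f : BinaryQuartic, f.Equivalent (ofPoint x y) ∧ f.a = 0 ∧ f.b ^ 2 ≤ 2 := by
  obtain ⟨f, hf, h⟩ := exists_reduced hk hxy
  rcases eq_or_ne f.a 0 with ha | ha
  · refine .inr ⟨f, hf.symm, ha, ?_⟩
    rcases h with h | h | h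
    · exact h.2
    · omega
    · omega
  left
  obtain ⟨n, hn1, hn2⟩ := exists_translate f ha
  have hg : (ofPoint x y).Equivalent (f.act 1 n 0 1) := hf.trans ⟨1, n, 0, 1, by ring, rfl⟩
  have hga : (f.act 1 n 0 1).a = f.a := by simp [act, eval]
  rw [← act_translate_hess f n, ← hga] at h
  rw [← hga] at ha hn1 hn2
  generalize f.act 1 n 0 1 = g at *
  have hI : g.invI = 4 := by rw [hg.invI_eq, invI_ofPoint]
  have hJ : -g.invJ = k := by rw [hg.invJ_eq, invJ_ofPoint]; linear_combination hxy
  have key : (g.a = 1 ∧ -2 ≤ -g.c ∧ -g.c ≤ 7 ∧ g.b = 0) ∨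
      g.e = 1 ∧ (g.d ^ 2 - g.c = 2 ∨ g.d ^ 2 - g.c = 3 ∨ g.d ^ 2 - g.c = 7) := by
    rcases h with ⟨h, -⟩ | ⟨rfl, h1, h2, h3, h4⟩ | ⟨rfl, h1, h2, h3, h4⟩
    · exact absurd h ha
    · rw [abs_of_pos h1] at hn1 hn2
      have hc := c_bounds_pos hn1 hn2 h3 h4 h1 h2
      have := firstCheck_pos g.a (Finset.mem_Icc.2 ⟨h1, h2⟩) g.b
        (Finset.mem_Icc.2 ⟨by omega, by omega⟩) g.c (Finset.mem_Icc.2 hc) hn1 hn2 h3 h4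
      rw [← hJ] at this
      refine (of_firstCheck hI ha this).imp_left fun h => ?_
      have hb : g.b = 0 := by omega
      rw [h, hb] at h3
      exact ⟨h, by omega, by omega, hb⟩
    · rw [abs_of_neg h1] at hn1 hn2
      rw [neg_neg] at hn2
      have hc := c_bounds_neg hn1 hn2 h3 h4 h1 h2
      have := firstCheck_neg g.a (Finset.mem_Icc.2 ⟨h2, by omega⟩) g.b
        (Finset.mem_Icc.2 ⟨by omega, by omega⟩) g.c (Finset.mem_Icc.2 hc) hn1 hn2 h3 h4
      rw [← hJ] at this
      exact (of_firstCheck hI ha this).imp_left fun h => by omega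
  rcases key with ⟨h1, h2, h3, h4⟩ | ⟨h1, h2⟩
  · exact ⟨-g.c, g.d, h2, h3, by rw [← eq_ofPoint h1 h4 hI]; exact hg.symm⟩
  · have hE : g.Equivalent (g.act 0 1 1 (-g.d)) := ⟨_, _, _, _, by ring, rfl⟩
    have := eq_ofPoint (f := g.act 0 1 1 (-g.d)) (by simp [act, eval, h1]) (by simp [act, h1])
      (by rw [hE.invI_eq, hI])
    have hc : (g.act 0 1 1 (-g.d)).c = g.c - g.d ^ 2 := by simp only [act, h1]; ring
    refine ⟨-(g.act 0 1 1 (-g.d)).c, (g.act 0 1 1 (-g.d)).d, by omega, by omega, ?_⟩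
    rw [← this]
    exact (hg.trans hE).symm

/-- The points whose forms represent zero. -/
lemma x_eq_of_a_eq_zero {x y k : ℤ} (hk : k = 25 ∨ k = -23)
    (hxy : y ^ 2 = 4 * x ^ 3 - 4 * x + k) {f : BinaryQuartic}
    (hf : f.Equivalent (ofPoint x y)) (ha : f.a = 0) (hb : f.b ^ 2 ≤ 2) :
    k = 25 ∧ x = 125 ∨ k = -23 ∧ x = 117 := by
  have hI : f.invI = 4 := by rw [← hf.invI_eq, invI_ofPoint]
  have hb0 : f.b ≠ 0 := by
    intro hb
    simp only [invI, ha, hb] at hI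
    omega
  have hb1 : f.b = 1 ∨ f.b = -1 := by
    have : f.b < 2 := by nlinarith
    have : -2 < f.b := by nlinarith
    omega
  have hbb : f.b ^ 2 = 1 := by rcases hb1 with h | h <;> rw [h] <;> rfl
  obtain ⟨m, hm⟩ : (2 : ℤ) ∣ f.c := by
    have : (2 : ℤ) ∣ f.c ^ 2 := by
      simp only [invI, ha] at hI
      have : (2 : ℤ) ∣ 3 * f.c ^ 2 := ⟨2 + 2 * f.b * f.d, by linarith⟩
      omega
    exact Int.prime_two.dvd_of_dvd_pow this
  have hg : (f.act 1 (-f.b * m) 0 1).Equivalent (ofPoint x y) :=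
    Equivalent.trans (Equivalent.symm ⟨1, -f.b * m, 0, 1, by ring, rfl⟩) hf
  have hga : (f.act 1 (-f.b * m) 0 1).a = 0 := by simp [act, eval, ha]
  have hgb : (f.act 1 (-f.b * m) 0 1).b = f.b := by simp [act, ha]
  have hgc : (f.act 1 (-f.b * m) 0 1).c = 0 := by
    simp only [act, ha, hm]; linear_combination -2 * m * hbb
  rw [← hgb] at hb1 hbb
  generalize f.act 1 (-f.b * m) 0 1 = g at *
  have hI : g.invI = 4 := by rw [← hg.invI_eq, invI_ofPoint]
  have hJ : -g.invJ = k := by rw [← hg.invJ_eq, invJ_ofPoint]; linear_combination hxy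
  simp only [invI, invJ, hga, hgc] at hI hJ
  have hd : g.d = -g.b := by
    rcases hb1 with h | h <;> rw [h] at hI ⊢ <;> linarith
  have he : g.e = k := by linear_combination hJ - g.e * hbb
  obtain ⟨p, q, r, s, hdet, h⟩ := hg
  have h1 : r * (4 * g.b * (p ^ 3 - p * r ^ 2) + k * r ^ 3) = 1 := by
    have := congrArg BinaryQuartic.a h
    simp only [ofPoint, act, eval, hga, hgc, hd, he] at this
    linear_combination -this
  have hx : x = p ^ 4 + 2 * p ^ 2 * r ^ 2 - 2 * g.b * k * p * r ^ 3 + r ^ 4 := by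
    have := hess_act g p q r s
    rw [hdet, ← h, hga, hgc, hd, he] at this
    simp only [ofPoint] at this
    linear_combination this + (2 * p ^ 2 * r ^ 2 + r ^ 4 + p ^ 4) * hbb
  have hroot : ∀ z : ℤ, z ^ 3 - z = 6 → z = 2 := fun z hz => by
    have : (z - 2) * (z ^ 2 + 2 * z + 3) = 0 := by linear_combination hz
    rcases mul_eq_zero.1 this with h | h
    · omega
    · nlinarith [sq_nonneg (z + 1)]
  have hr := Int.isUnit_iff.1 (IsUnit.of_mul_eq_one _ h1)
  have hroot' : ∀ z : ℤ, z ^ 3 - z = -6 → z = -2 := fun z hz => by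
    have := hroot (-z) (by linear_combination -hz)
    omega
  rcases hk with rfl | rfl <;> rcases hb1 with hb | hb <;> rcases hr with rfl | rfl <;>
    rw [hb] at h1 hx <;>
    first
      | rw [hroot p (by linarith)] at hx; omega
      | rw [hroot' p (by linarith)] at hx; omega

end BinaryQuartic

namespace Quart

open BinaryQuartic in
lemma exists_small_point {x y k : ℤ} (hk : k = 25 ∨ k = -23)
    (hxy : y ^ 2 = 4 * x ^ 3 - 4 * x + k) :
    (∃ x' y' u v, -2 ≤ x' ∧ x' ≤ 7 ∧ 0 ≤ y' ∧ y' ^ 2 = 4 * x' ^ 3 - 4 * x' + k ∧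
      form x' y' u v = 1 ∧ x = hess x' y' u v ∧ (y = sextic x' y' u v ∨ y = -sextic x' y' u v)) ∨
      k = 25 ∧ x = 125 ∨ k = -23 ∧ x = 117 := by
  rcases exists_equivalent_ofPoint hk hxy with ⟨x', y', h1, h2, h⟩ | ⟨f, hf, ha, hb⟩
  · left
    have h3 : y' ^ 2 = 4 * x' ^ 3 - 4 * x' + k := by
      have := h.invJ_eq
      rw [invJ_ofPoint, invJ_ofPoint] at this
      linear_combination hxy + this
    obtain ⟨u, v, h4, h5, h6⟩ := h.ofPoint_eq
    rcases le_total 0 y' with hy | hy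
    · exact ⟨x', y', u, v, h1, h2, hy, h3, h4, h5, h6⟩
    · have hs : sextic x' (-y') u (-v) = -sextic x' y' u v := by simp only [sextic]; ring
      refine ⟨x', -y', u, -v, h1, h2, by omega, by linear_combination h3, ?_, ?_, ?_⟩
      · rw [← h4]; simp only [form]; ring
      · rw [h5]; simp only [hess]; ring
      · rwa [hs, neg_neg, or_comm]
  · exact .inr (x_eq_of_a_eq_zero hk hxy hf ha hb)

lemma hess_eq_of_mem {x y u v a b : ℤ} (h : u = a ∧ v = b ∨ -u = a ∧ -v = b) :
    hess x y u v = hess x y a b := by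
  rcases h with ⟨rfl, rfl⟩ | ⟨rfl, rfl⟩
  · rfl
  · rw [hess_neg]

lemma not_sq_of_lt {n s t : ℤ} (h1 : s ^ 2 < n) (h2 : n < (s + 1) ^ 2)
    (hs : 0 ≤ s) : t ^ 2 ≠ n := by
  rintro rfl
  rw [sq_lt_sq, abs_of_nonneg hs] at h1
  rw [sq_lt_sq, abs_of_nonneg (by omega : 0 ≤ s + 1)] at h2
  omega

theorem x_eq_of_point_pos {x y t : ℤ} (hxy : y ^ 2 = 4 * x ^ 3 - 4 * x + 25)
    (ht : t ^ 2 = 4 * y + 5) (hy : 0 ≤ y) (hx : 4 ≤ x) : x = 33 := by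
  have hbad : ∀ n s : ℤ, y ^ 2 = n ^ 2 → 0 ≤ n → 0 ≤ s → s ^ 2 < 4 * n + 5 →
      4 * n + 5 < (s + 1) ^ 2 → False := fun n s h hn hs h1 h2 => by
    rw [(sq_eq_sq₀ hy hn).1 h] at ht
    exact not_sq_of_lt h1 h2 hs ht
  rcases exists_small_point (.inl rfl) hxy with
    ⟨x', y', u, v, h1, h2, hy', h3, h4, h5, h6⟩ | ⟨-, h⟩ | ⟨h, -⟩
  · have hs : t ^ 2 = 4 * sextic x' y' u v + 5 ∨ t ^ 2 = -4 * sextic x' y' u v + 5 := by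
      rcases h6 with h | h <;> rw [h] at ht
      · exact .inl ht
      · exact .inr (by linarith)
    clear h6
    interval_cases x'
    · obtain rfl := (sq_eq_sq₀ hy' (by norm_num : (0 : ℤ) ≤ 1)).1 (by linarith)
      rcases solutions_neg_two_one u v t h4 hs with h
      rw [← or_assoc] at h
      rcases h with h | h <;> rw [hess_eq_of_mem h] at h5 <;> norm_num [hess] at h5 <;> omega
    · obtain rfl := (sq_eq_sq₀ hy' (by norm_num : (0 : ℤ) ≤ 5)).1 (by linarith)
      rcases solutions_neg_one_five u v t h4 hs with h
      rw [← or_assoc] at h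
      rcases h with h | h <;> rw [hess_eq_of_mem h] at h5 <;> norm_num [hess] at h5
      · omega
      · rw [h5] at hxy
        exact (hbad 1325 72 (by linarith) (by norm_num) (by norm_num) (by norm_num)
          (by norm_num)).elim
    · obtain rfl := (sq_eq_sq₀ hy' (by norm_num : (0 : ℤ) ≤ 5)).1 (by linarith)
      rcases solutions_zero_five u v t h4 hs with h
      rw [← or_assoc] at h
      rcases h with h | h <;> rw [hess_eq_of_mem h] at h5 <;> norm_num [hess] at h5
      · omega
      · rw [h5] at hxy
        exact (hbad 3887515 3943 (by linarith) (by norm_num) (by norm_num) (by norm_num)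
          (by norm_num)).elim
    · obtain rfl := (sq_eq_sq₀ hy' (by norm_num : (0 : ℤ) ≤ 5)).1 (by linarith)
      rcases solutions_one_five u v t h4 hs with h
      rw [← or_assoc] at h
      rcases h with h | h <;> rw [hess_eq_of_mem h] at h5 <;> norm_num [hess] at h5
      · omega
      · rw [h5] at hxy
        exact (hbad 265 32 (by linarith) (by norm_num) (by norm_num) (by norm_num)
          (by norm_num)).elim
    · obtain rfl := (sq_eq_sq₀ hy' (by norm_num : (0 : ℤ) ≤ 7)).1 (by linarith)
      exact (solutions_two_seven u v t h4 hs).elim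
    · obtain rfl := (sq_eq_sq₀ hy' (by norm_num : (0 : ℤ) ≤ 11)).1 (by linarith)
      rw [hess_eq_of_mem (solutions_three_eleven u v t h4 hs)] at h5
      norm_num [hess] at h5
      omega
    · exact (not_sq_of_lt (n := 265) (t := y') (s := 16) (by norm_num) (by norm_num) (by norm_num)
        (by linarith)).elim
    · exact (not_sq_of_lt (n := 505) (t := y') (s := 22) (by norm_num) (by norm_num) (by norm_num)
        (by linarith)).elim
    · exact (not_sq_of_lt (n := 865) (t := y') (s := 29) (by norm_num) (by norm_num) (by norm_num)
        (by linarith)).elim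
    · obtain rfl := (sq_eq_sq₀ hy' (by norm_num : (0 : ℤ) ≤ 37)).1 (by linarith)
      exact (solutions_seven_thirtySeven u v t h4 hs).elim
  · rw [h] at hxy
    exact (hbad 2795 105 (by linarith) (by norm_num) (by norm_num) (by norm_num)
      (by norm_num)).elim
  · norm_num at h

theorem x_eq_of_point_neg {x y t : ℤ} (hxy : y ^ 2 = 4 * x ^ 3 - 4 * x - 23)
    (ht : t ^ 2 = 4 * y + 5) (hy : 0 ≤ y) : x = 2 := by
  rcases exists_small_point (.inr rfl) (hxy.trans (sub_eq_add_neg _ _)) with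
    ⟨x', y', u, v, h1, h2, hy', h3, h4, h5, h6⟩ | ⟨h, -⟩ | ⟨-, h⟩
  · have hs : t ^ 2 = 4 * sextic x' y' u v + 5 ∨ t ^ 2 = -4 * sextic x' y' u v + 5 := by
      rcases h6 with h | h <;> rw [h] at ht
      · exact .inl ht
      · exact .inr (by linarith)
    clear h6
    have hneg : ∀ z s : ℤ, y' ^ 2 = z → s ^ 2 < z → z < (s + 1) ^ 2 → 0 ≤ s → False :=
      fun z s h h1 h2 hs => not_sq_of_lt h1 h2 hs h
    have hlow : 2 ≤ x' := by
      by_contra! h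
      have : 0 ≤ 4 * x' ^ 3 - 4 * x' + -23 := h3 ▸ sq_nonneg y'
      interval_cases x' <;> norm_num at this
    interval_cases x'
    · obtain rfl := (sq_eq_sq₀ hy' (by norm_num : (0 : ℤ) ≤ 1)).1 (by linarith)
      rw [hess_eq_of_mem (solutions_two_one u v t h4 hs)] at h5
      norm_num [hess] at h5
      exact h5
    · exact (hneg 73 8 (by linarith) (by norm_num) (by norm_num) (by norm_num)).elim
    · exact (hneg 217 14 (by linarith) (by norm_num) (by norm_num) (by norm_num)).elim
    · exact (hneg 457 21 (by linarith) (by norm_num) (by norm_num) (by norm_num)).elim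
    · exact (hneg 817 28 (by linarith) (by norm_num) (by norm_num) (by norm_num)).elim
    · exact (hneg 1321 36 (by linarith) (by norm_num) (by norm_num) (by norm_num)).elim
  · norm_num at h
  · rw [h] at hxy
    rw [(sq_eq_sq₀ hy (by norm_num : (0 : ℤ) ≤ 2531)).1 (by linarith)] at ht
    exact (not_sq_of_lt (s := 100) (by norm_num) (by norm_num) (by norm_num) ht).elim

end Quart

lemma twentyFour_mul_choose_four (j : ℕ) :
    (24 : ℤ) * ((j + 3).choose 4 : ℕ) = (j + 3) * (j + 2) * (j + 1) * j := by
  have h := Nat.descFactorial_eq_factorial_mul_choose (j + 3) 4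
  simp only [Nat.descFactorial, Nat.factorial] at h
  zify at h
  simp at h
  linear_combination -h

lemma six_mul_choose_three (j : ℕ) :
    (6 : ℤ) * ((j + 2).choose 3 : ℕ) = (j + 2) * (j + 1) * j := by
  have h := Nat.descFactorial_eq_factorial_mul_choose (j + 2) 3
  simp only [Nat.descFactorial, Nat.factorial] at h
  zify at h
  simp at h
  linear_combination -h

theorem near_collisions_diff_one_34 :
    (∀ n m : ℕ, 6 ≤ n → 8 ≤ m →
      (Nat.choose m 4 = Nat.choose n 3 + 1 ↔ (n, m) = (34, 21))) ∧
    (∀ n m : ℕ, 8 ≤ n → 6 ≤ m →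
      Nat.choose m 3 ≠ Nat.choose n 4 + 1) := by
  refine ⟨fun n m hn hm => ⟨fun h => ?_, ?_⟩, fun n m hn hm h => ?_⟩
  · obtain ⟨i, rfl⟩ := Nat.exists_eq_add_of_le' (show 2 ≤ n by omega)
    obtain ⟨j, rfl⟩ := Nat.exists_eq_add_of_le' (show 3 ≤ m by omega)
    have h3 := six_mul_choose_three i
    have h4 := twentyFour_mul_choose_four j
    rw [h] at h4
    push_cast at h4
    have hx := Quart.x_eq_of_point_pos (x := i + 1) (y := j ^ 2 + 3 * j + 1) (t := 2 * j + 3)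
      (by linear_combination 4 * h3 - h4) (by ring) (by positivity) (by omega)
    have hi : i = 32 := by omega
    subst hi
    have hj : (j : ℤ) ^ 2 + 3 * j + 1 = 379 := by
      refine (sq_eq_sq₀ (by positivity) (by norm_num)).1 ?_
      norm_num at h3
      linear_combination 4 * h3 - h4
    have : j = 18 := by nlinarith
    subst this
    rfl
  · simp only [Prod.mk.injEq]
    rintro ⟨rfl, rfl⟩
    decide +kernel
  · obtain ⟨i, rfl⟩ := Nat.exists_eq_add_of_le' (show 3 ≤ n by omega)
    obtain ⟨j, rfl⟩ := Nat.exists_eq_add_of_le' (show 2 ≤ m by omega)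
    have h3 := six_mul_choose_three j
    have h4 := twentyFour_mul_choose_four i
    rw [h] at h3
    push_cast at h3
    have hx := Quart.x_eq_of_point_neg (x := j + 1) (y := i ^ 2 + 3 * i + 1) (t := 2 * i + 3)
      (by linear_combination 4 * h3 - h4) (by ring) (by positivity)
    omega
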